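/- Let W = w₁⊗⋯⊗wₙ ∈ ℝ^{d₁×⋯×dₙ} be a CP rank-one tensor whose every entry lies in [1/√(d₁⋯dₙ), 1], and let Ω ∼ W be a random subset of [d₁]×⋯×[dₙ] (each tuple included independently with probability W_{i₁⋯iₙ}). Then with probability at least 1 − 2exp(−(3/104)√(∏_{j=1}^n d_j)) − Σ_{k=1}^n 2/(d_k + ∏_{j≠k}d_j) over the choice of Ω, the following holds: for every σ, β > 0 and every tensor T of Tucker rank r = (r₁,…,rₙ) with ‖T‖_∞ ≤ β, if Z has i.i.d. entries Z_{i₁⋯iₙ} ∼ N(0,σ²) and T̂ is the weighted HOSVD estimate built from Y_Ω = 1_Ω∘(T+Z), then with probability at least 1 − Σ_{k=1}^n 1/(d_k + ∏_{j≠k}d_j) over the choice of Z, ‖W^{(1/2)}∘(T−T̂)‖_F / ‖W^{(1/2)}‖_F ≤ (√5·β/√|Ω|)·Σ_{k=1}^n 3r_k√(d_k + ∏_{j≠k}d_j)·log(d_k + ∏_{j≠k}d_j) + (√5·σ/√|Ω|)·Σ_{k=1}^n 6√(r_k(d_k + ∏_{j≠k}d_j))·log(d_k + ∏_{j≠k}d_j).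 -/

import Mathlib

open MeasureTheory ProbabilityTheory Matrix
open scoped BigOperators ENNReal

namespace WTC

variable {n : ℕ}

/-- The index set `[d₁] × ⋯ × [dₙ]`. -/
abbrev Index (d : Fin n → ℕ) := ∀ j, Fin (d j)

/-- A real tensor of size `d₁ × ⋯ × dₙ`. -/
abbrev Tensor (d : Fin n → ℕ) := Index d → ℝ

variable {d : Fin n → ℕ}

/-- Frobenius norm of a tensor. -/
noncomputable def frobNorm (X : Tensor d) : ℝ :=
  Real.sqrt (∑ i : Index d, X i ^ 2)

/-- Sup (max-abs-entry) norm of a tensor. -/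
noncomputable def infNorm (X : Tensor d) : ℝ := ⨆ i : Index d, |X i|

/-- Hadamard (entrywise) product. -/
def hadamard (X Y : Tensor d) : Tensor d := fun i => X i * Y i

/-- Entrywise real power `X^{(α)}`. -/
noncomputable def epow (X : Tensor d) (α : ℝ) : Tensor d := fun i => X i ^ α

/-- The indicator tensor `1_Ω` of a sampling pattern. -/
def indic (Ω : Finset (Index d)) : Tensor d := fun i => if i ∈ Ω then 1 else 0

/-- The CP rank-one tensor `w₁ ⊗ ⋯ ⊗ wₙ`. -/
def outer (w : ∀ j, Fin (d j) → ℝ) : Tensor d := fun i => ∏ j, w j (i j)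

/-- Index type for the columns of the mode-`k` matricization. -/
abbrev RestIdx (d : Fin n → ℕ) (k : Fin n) := ∀ j : {j : Fin n // j ≠ k}, Fin (d j.1)

/-- Assemble a full index from a mode-`k` index and the remaining indices. -/
def embed (k : Fin n) (ik : Fin (d k)) (rest : RestIdx d k) : Index d :=
  fun j => if h : j = k then cast (congrArg (fun t => Fin (d t)) h).symm ik else rest ⟨j, h⟩

/-- Mode-`k` matricization of a tensor. -/
def matricize (k : Fin n) (X : Tensor d) : Matrix (Fin (d k)) (RestIdx d k) ℝ :=
  fun ik rest => X (embed k ik rest)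

/-- Spectral norm (largest singular value) of a matrix. -/
noncomputable def specNorm {m l : Type*} [Fintype m] [Fintype l] [DecidableEq l]
    (M : Matrix m l ℝ) : ℝ :=
  ‖LinearMap.toContinuousLinearMap (Matrix.toEuclideanLin M)‖

/-- `X` has Tucker rank at most `r`. -/
def TuckerRankLE (X : Tensor d) (r : Fin n → ℕ) : Prop :=
  ∀ k, (matricize k X).rank ≤ r k

/-- `X` has Tucker rank exactly `r`. -/
def TuckerRankEq (X : Tensor d) (r : Fin n → ℕ) : Prop :=
  ∀ k, (matricize k X).rank = r k

/-- `X` has CP rank at most `r`. -/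
def CPRankLE (X : Tensor d) (r : ℕ) : Prop :=
  ∃ v : Fin r → ∀ j, Fin (d j) → ℝ, X = fun i => ∑ s, ∏ j, v s j (i j)

/-- Mode-`k` product of a tensor with a square matrix: `(X ×ₖ A)_(k) = A · X_(k)`. -/
noncomputable def modeProd (k : Fin n) (X : Tensor d)
    (A : Matrix (Fin (d k)) (Fin (d k)) ℝ) : Tensor d :=
  fun i => ∑ s : Fin (d k), A (i k) s * X (Function.update i k s)

/-- Sequential mode products `X ×₁ A₁ ×₂ ⋯ ×ₙ Aₙ`. -/
noncomputable def modeProds (X : Tensor d)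
    (A : ∀ k, Matrix (Fin (d k)) (Fin (d k)) ℝ) : Tensor d :=
  (List.finRange n).foldl (fun Y k => modeProd k Y (A k)) X

/-- `That` is a weighted HOSVD estimate built from observations `Y` (typically `Y = Y_Ω`),
weight `W` and multilinear rank `r`. -/
def IsHOSVDEstimate (W : Tensor d) (r : Fin n → ℕ) (Y : Tensor d) (That : Tensor d) : Prop :=
  ∃ U : ∀ k, Matrix (Fin (d k)) (Fin (r k)) ℝ,
    (∀ k, (U k)ᵀ * U k = 1) ∧
    (∀ k, ∀ B : Matrix (Fin (d k)) (RestIdx d k) ℝ, B.rank ≤ r k →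
      specNorm (matricize k (hadamard (epow W (-(1/2))) Y)
          - U k * (U k)ᵀ * matricize k (hadamard (epow W (-(1/2))) Y))
        ≤ specNorm (matricize k (hadamard (epow W (-(1/2))) Y) - B)) ∧
    That = hadamard (epow W (-(1/2)))
      (modeProds (hadamard (epow W (-(1/2))) Y) (fun k => U k * (U k)ᵀ))

/-- Distribution of a tensor with i.i.d. `N(0, σ²)` entries. -/
noncomputable def gaussianTensor (d : Fin n → ℕ) (σ : ℝ) : Measure (Tensor d) :=
  Measure.pi fun _ : Index d => gaussianReal 0 (σ ^ 2).toNNReal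

/-- Bernoulli measure on `Bool` with success probability `p`. -/
noncomputable def bern (p : ℝ) : Measure Bool :=
  ENNReal.ofReal p • Measure.dirac true + ENNReal.ofReal (1 - p) • Measure.dirac false

/-- Distribution of a random sampling pattern `Ω ∼ W`: each index is included
independently with probability `W i`.  A pattern is encoded as a boolean function. -/
noncomputable def sampleMeasure (W : Tensor d) : Measure (Index d → Bool) :=
  Measure.pi fun i => bern (W i)

/-- Indicator tensor of a boolean sampling pattern. -/
def bindic (ω : Index d → Bool) : Tensor d := fun i => if ω i then 1 else 0

/-- The size `|Ω|` of a boolean sampling pattern. -/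
noncomputable def patCard (ω : Index d → Bool) : ℕ :=
  (Finset.univ.filter fun i : Index d => ω i = true).card


/-- `ℓ¹` norm of a vector. -/
noncomputable def l1 {ι : Type*} [Fintype ι] (v : ι → ℝ) : ℝ := ∑ i, |v i|

/-- `ℓ²` norm of a vector. -/
noncomputable def l2 {ι : Type*} [Fintype ι] (v : ι → ℝ) : ℝ := Real.sqrt (∑ i, v i ^ 2)

/-- `ℓ^∞` norm of a vector. -/
noncomputable def linf {ι : Type*} [Fintype ι] (v : ι → ℝ) : ℝ := ⨆ i, |v i|

/-- Frobenius norm of a matrix. -/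
noncomputable def matFrob {m l : Type*} [Fintype m] [Fintype l] (M : Matrix m l ℝ) : ℝ :=
  Real.sqrt (∑ i, ∑ j, M i j ^ 2)

/-- Kronecker product of a family of square matrices (indexed functionally). -/
def kronFamily {r : Fin n → ℕ} (M : ∀ k, Matrix (Fin (r k)) (Fin (r k)) ℝ) :
    Matrix (∀ k, Fin (r k)) (∀ k, Fin (r k)) ℝ :=
  fun i j => ∏ k, M k (i k) (j k)

/-- The quantity `d_k + ∏_{j ≠ k} d_j`. -/
noncomputable def Dk (d : Fin n → ℕ) (k : Fin n) : ℝ :=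
  (d k : ℝ) + ∏ j ∈ Finset.univ.erase k, (d j : ℝ)

/-- The vector `w_k = (h_k ∘ b_k)^{(2)}`. -/
def wvec {d : Fin n → ℕ} (h b : ∀ j, Fin (d j) → ℝ) (k : Fin n) : Fin (d k) → ℝ :=
  fun ik => (h k ik * b k ik) ^ 2

/-- Law of a uniformly random `±1`-valued tensor (encoded by booleans). -/
noncomputable def signMeasure (ι : Type*) [Fintype ι] [DecidableEq ι] : Measure (ι → Bool) :=
  (PMF.uniformOfFintype (ι → Bool)).toMeasure

/-- Law of a random vector with i.i.d. entries equal to `1` with probability `1/4`,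
`-1` with probability `1/4` and `0` with probability `1/2`. -/
noncomputable def xiMeasure (ι : Type*) [Fintype ι] [DecidableEq ι] : Measure (ι → ℝ) :=
  ((PMF.uniformOfFintype (ι → Fin 4)).map
    (fun b i => (![0, 0, 1, -1] : Fin 4 → ℝ) (b i))).toMeasure

theorem exists_spectral_pow {ι : Type*} [Fintype ι] [DecidableEq ι] {S : Matrix ι ι ℝ}
    (hS : S.IsHermitian) :
    ∃ (U : Matrix ι ι ℝ) (lam : ι → ℝ), U * Uᵀ = 1 ∧ Uᵀ * U = 1 ∧
      ∀ q : ℕ, S ^ q = U * diagonal (fun a => lam a ^ q) * Uᵀ := by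
  have h1 : (hS.eigenvectorUnitary : Matrix ι ι ℝ) * (hS.eigenvectorUnitary : Matrix ι ι ℝ)ᵀ = 1 := by
    have := Unitary.mul_star_self_of_mem hS.eigenvectorUnitary.2
    rwa [star_eq_conjTranspose, conjTranspose_eq_transpose_of_trivial] at this
  have h2 : (hS.eigenvectorUnitary : Matrix ι ι ℝ)ᵀ * (hS.eigenvectorUnitary : Matrix ι ι ℝ) = 1 := by
    have := Unitary.star_mul_self_of_mem hS.eigenvectorUnitary.2
    rwa [star_eq_conjTranspose, conjTranspose_eq_transpose_of_trivial] at this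
  refine ⟨hS.eigenvectorUnitary, hS.eigenvalues, h1, h2, fun q => ?_⟩
  induction q with
  | zero => simp [h1]
  | succ q ih =>
    have hs : S = (hS.eigenvectorUnitary : Matrix ι ι ℝ) * diagonal hS.eigenvalues
        * (hS.eigenvectorUnitary : Matrix ι ι ℝ)ᵀ := by
      conv_lhs => rw [hS.spectral_theorem, Unitary.conjStarAlgAut_apply]
      simp only [star_eq_conjTranspose, conjTranspose_eq_transpose_of_trivial]
      rfl
    generalize (hS.eigenvectorUnitary : Matrix ι ι ℝ) = U at *
    generalize hS.eigenvalues = lam at *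
    rw [pow_succ, ih]
    conv_lhs => rw [hs]
    calc _ = U * diagonal (fun a => lam a ^ q) * (Uᵀ * U) * diagonal lam * Uᵀ := by
          simp only [Matrix.mul_assoc]
      _ = _ := by
          rw [h2, Matrix.mul_one, Matrix.mul_assoc U, diagonal_mul_diagonal]
          simp only [pow_succ]

theorem trace_mul_diag_mul_diag {ι : Type*} [Fintype ι] [DecidableEq ι]
    {A : Matrix ι ι ℝ} (hA : Aᵀ = A) (U V : Matrix ι ι ℝ) (f g : ι → ℝ) :
    trace (A * (U * diagonal f * Uᵀ) * A * (V * diagonal g * Vᵀ))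
      = ∑ a, ∑ b, f a * g b * (Uᵀ * A * V) a b ^ 2 := by
  have h : trace (A * (U * diagonal f * Uᵀ) * A * (V * diagonal g * Vᵀ))
      = trace (diagonal f * (Uᵀ * A * V) * (diagonal g * (Uᵀ * A * V)ᵀ)) := by
    rw [transpose_mul, transpose_mul, transpose_transpose, hA]
    calc _ = trace (A * U * (diagonal f * Uᵀ * A * V * diagonal g * Vᵀ)) := by
          simp only [Matrix.mul_assoc]
      _ = _ := by
          rw [trace_mul_comm]; simp only [Matrix.mul_assoc]
  rw [h, trace]
  refine Finset.sum_congr rfl fun a _ => ?_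
  rw [diag_apply, mul_apply]
  refine Finset.sum_congr rfl fun b _ => ?_
  rw [diagonal_mul, diagonal_mul, transpose_apply]
  ring

theorem pow_mul_pow_add_le {m q : ℕ} (hm : Even m) (hq : q ≤ m) (x y : ℝ) :
    x ^ q * y ^ (m - q) + x ^ (m - q) * y ^ q ≤ x ^ m + y ^ m := by
  have habs : x ^ q * y ^ (m - q) + x ^ (m - q) * y ^ q
      ≤ |x| ^ q * |y| ^ (m - q) + |x| ^ (m - q) * |y| ^ q := by
    simp only [← abs_pow, ← abs_mul]
    exact add_le_add (le_abs_self _) (le_abs_self _)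
  have hx : x ^ m = |x| ^ q * |x| ^ (m - q) := by
    rw [← pow_add, Nat.add_sub_cancel' hq, hm.pow_abs]
  have hy : y ^ m = |y| ^ q * |y| ^ (m - q) := by
    rw [← pow_add, Nat.add_sub_cancel' hq, hm.pow_abs]
  rw [hx, hy]
  have key : 0 ≤ (|x| ^ q - |y| ^ q) * (|x| ^ (m - q) - |y| ^ (m - q)) := by
    rcases le_total |x| |y| with h | h
    · exact mul_nonneg_of_nonpos_of_nonpos
        (sub_nonpos.2 (pow_le_pow_left₀ (abs_nonneg _) h _))
        (sub_nonpos.2 (pow_le_pow_left₀ (abs_nonneg _) h _))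
    · exact mul_nonneg (sub_nonneg.2 (pow_le_pow_left₀ (abs_nonneg _) h _))
        (sub_nonneg.2 (pow_le_pow_left₀ (abs_nonneg _) h _))
  nlinarith

theorem sum_pow_mul_pow_le {m : ℕ} (hm : Even m) (x y : ℝ) :
    ∑ q ∈ Finset.range (m + 1), x ^ q * y ^ (m - q) ≤ (m + 1) / 2 * (x ^ m + y ^ m) := by
  have h1 : ∑ q ∈ Finset.range (m + 1), x ^ q * y ^ (m - q)
      = ∑ q ∈ Finset.range (m + 1), x ^ (m - q) * y ^ q := by
    rw [← Finset.sum_range_reflect]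
    refine Finset.sum_congr rfl fun q hq => ?_
    have : q ≤ m := Nat.lt_succ_iff.1 (Finset.mem_range.1 hq)
    rw [show m + 1 - 1 - q = m - q by omega, Nat.sub_sub_self this]
  have h2 : ∑ q ∈ Finset.range (m + 1), (x ^ q * y ^ (m - q) + x ^ (m - q) * y ^ q)
      ≤ ∑ q ∈ Finset.range (m + 1), (x ^ m + y ^ m) :=
    Finset.sum_le_sum fun q hq =>
      pow_mul_pow_add_le hm (Nat.lt_succ_iff.1 (Finset.mem_range.1 hq)) x y
  rw [Finset.sum_add_distrib, ← h1, Finset.sum_const, Finset.card_range, nsmul_eq_mul] at h2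
  push_cast at h2
  linarith

theorem sum_trace_mul_pow_le {ι : Type*} [Fintype ι] [DecidableEq ι] {A S R : Matrix ι ι ℝ}
    (hA : Aᵀ = A) (hS : S.IsHermitian) (hR : R.IsHermitian) {m : ℕ} (hm : Even m) :
    ∑ q ∈ Finset.range (m + 1), trace (A * S ^ q * A * R ^ (m - q))
      ≤ (m + 1) / 2 * (trace (A * A * S ^ m) + trace (A * A * R ^ m)) := by
  obtain ⟨U, lam, hU1, hU2, hU⟩ := exists_spectral_pow hS
  obtain ⟨V, mu, hV1, hV2, hV⟩ := exists_spectral_pow hR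
  have key : ∀ q s : ℕ, trace (A * S ^ q * A * R ^ s)
      = ∑ a, ∑ b, lam a ^ q * mu b ^ s * (Uᵀ * A * V) a b ^ 2 := by
    intro q s
    rw [hU, hV, trace_mul_diag_mul_diag hA]
  have hS' : trace (A * A * S ^ m) = ∑ a, ∑ b, lam a ^ m * mu b ^ 0 * (Uᵀ * A * V) a b ^ 2 := by
    rw [← key, pow_zero, Matrix.mul_one, Matrix.mul_assoc, trace_mul_comm]
  have hR' : trace (A * A * R ^ m) = ∑ a, ∑ b, lam a ^ 0 * mu b ^ m * (Uᵀ * A * V) a b ^ 2 := by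
    rw [← key, pow_zero, Matrix.mul_one]
  rw [hS', hR', Finset.sum_congr rfl fun q _ => key q (m - q), Finset.sum_comm,
    ← Finset.sum_add_distrib, Finset.mul_sum]
  refine Finset.sum_le_sum fun a _ => ?_
  rw [Finset.sum_comm, ← Finset.sum_add_distrib, Finset.mul_sum]
  refine Finset.sum_le_sum fun b _ => ?_
  rw [← Finset.sum_mul]
  have := mul_le_mul_of_nonneg_right (sum_pow_mul_pow_le hm (lam a) (mu b))
    (sq_nonneg ((Uᵀ * A * V) a b))
  simp only [pow_zero]
  nlinarith

theorem pow_sub_pow_eq_sum {R : Type*} [Ring R] (S T : R) (m : ℕ) :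
    S ^ (m + 1) - T ^ (m + 1) = ∑ q ∈ Finset.range (m + 1), S ^ q * (S - T) * T ^ (m - q) := by
  induction m with
  | zero => simp
  | succ m ih =>
    rw [Finset.sum_range_succ]
    have : ∑ q ∈ Finset.range (m + 1), S ^ q * (S - T) * T ^ (m + 1 - q)
        = (S ^ (m + 1) - T ^ (m + 1)) * T := by
      rw [ih, Finset.sum_mul]
      refine Finset.sum_congr rfl fun q hq => ?_
      have : q ≤ m := Nat.lt_succ_iff.1 (Finset.mem_range.1 hq)
      rw [show m + 1 - q = (m - q) + 1 by omega, pow_succ]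
      simp only [mul_assoc]
    rw [this, Nat.sub_self, pow_zero, mul_one, pow_succ S (m + 1), pow_succ T (m + 1)]
    noncomm_ring

/-- A mean value inequality for trace powers along a symmetric direction. -/
theorem mul_trace_pow_sub_le {ι : Type*} [Fintype ι] [DecidableEq ι] {A S R : Matrix ι ι ℝ}
    (hA : Aᵀ = A) (hS : S.IsHermitian) (hR : R.IsHermitian) {m : ℕ} (hm : Even m) {c : ℝ}
    (hc : S - R = c • A) :
    c * (trace (A * S ^ (m + 1)) - trace (A * R ^ (m + 1)))
      ≤ c ^ 2 * ((m + 1) / 2 * (trace (A * A * S ^ m) + trace (A * A * R ^ m))) := by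
  have h : trace (A * S ^ (m + 1)) - trace (A * R ^ (m + 1))
      = c * ∑ q ∈ Finset.range (m + 1), trace (A * S ^ q * A * R ^ (m - q)) := by
    rw [← trace_sub, ← Matrix.mul_sub, pow_sub_pow_eq_sum, hc, Finset.mul_sum, trace_sum,
      Finset.mul_sum]
    refine Finset.sum_congr rfl fun q _ => ?_
    rw [Matrix.mul_smul, Matrix.smul_mul, Matrix.mul_smul, trace_smul, smul_eq_mul]
    simp only [Matrix.mul_assoc]
  rw [h, ← mul_assoc, ← sq]
  exact mul_le_mul_of_nonneg_left (sum_trace_mul_pow_le hA hS hR hm) (sq_nonneg c)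

theorem mul_pow_le_young {a b : ℝ} (ha : 0 ≤ a) (hb : 0 ≤ b) (p : ℕ) :
    ((p : ℝ) + 1) * (a * b ^ p) ≤ a ^ (p + 1) + p * b ^ (p + 1) := by
  rcases hb.eq_or_lt with rfl | hb
  · rcases p with _ | p
    · simp
    · simp; positivity
  · have h := one_add_mul_le_pow (a := a / b - 1) (by have := div_nonneg ha hb.le; linarith) (p + 1)
    have h' := mul_le_mul_of_nonneg_right h (pow_pos hb (p + 1)).le
    rw [← mul_pow, add_sub_cancel, div_mul_cancel₀ _ hb.ne'] at h'
    have e : (1 + ((p + 1 : ℕ) : ℝ) * (a / b - 1)) * b ^ (p + 1)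
        = ((p : ℝ) + 1) * (a * b ^ p) - p * b ^ (p + 1) := by
      push_cast; field_simp; ring
    linarith

theorem sum_mul_pow_diag_le {ι : Type*} [Fintype ι] [DecidableEq ι] {X : Matrix ι ι ℝ}
    (hX : X.IsHermitian) {a : ι → ℝ} (ha : ∀ i, 0 ≤ a i) (p : ℕ) :
    ((p : ℝ) + 1) * ∑ i, a i * (X ^ (2 * p)) i i
      ≤ ∑ i, a i ^ (p + 1) + p * trace (X ^ (2 * (p + 1))) := by
  obtain ⟨U, lam, hU1, hU2, hU⟩ := exists_spectral_pow hX
  have key : ∀ q i, (X ^ q) i i = ∑ b, lam b ^ q * U i b ^ 2 := by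
    intro q i
    rw [hU, mul_apply]
    refine Finset.sum_congr rfl fun b _ => ?_
    rw [mul_diagonal, transpose_apply]; ring
  have h1 : ∀ i, ∑ b, U i b ^ 2 = 1 := by
    intro i
    have := congrFun (congrFun hU1 i) i
    rw [mul_apply, one_apply_eq] at this
    rw [← this]
    exact Finset.sum_congr rfl fun b _ => by rw [transpose_apply]; ring
  rw [trace, Finset.mul_sum, Finset.mul_sum, ← Finset.sum_add_distrib]
  refine Finset.sum_le_sum fun i _ => ?_
  rw [diag_apply, key, key]
  have : a i ^ (p + 1) = ∑ b, a i ^ (p + 1) * U i b ^ 2 := by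
    rw [← Finset.mul_sum, h1, mul_one]
  rw [this, Finset.mul_sum, Finset.mul_sum, Finset.mul_sum, ← Finset.sum_add_distrib]
  refine Finset.sum_le_sum fun b _ => ?_
  have := mul_le_mul_of_nonneg_right (mul_pow_le_young (ha i) (sq_nonneg (lam b)) p)
    (sq_nonneg (U i b))
  rw [pow_mul, pow_mul]
  linarith

theorem sum_mulVec_sq_le_of_trace_pow_le {ι : Type*} [Fintype ι] [DecidableEq ι]
    {X : Matrix ι ι ℝ} (hX : X.IsHermitian) {p : ℕ} (hp : p ≠ 0) {t : ℝ}
    (h : trace (X ^ (2 * p)) ≤ t ^ (2 * p)) (u : ι → ℝ) :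
    ∑ i, (X *ᵥ u) i ^ 2 ≤ t ^ 2 * ∑ i, u i ^ 2 := by
  obtain ⟨U, lam, hU1, hU2, hU⟩ := exists_spectral_pow hX
  have hlam : ∀ a, lam a ^ 2 ≤ t ^ 2 := by
    intro a
    have htr : trace (X ^ (2 * p)) = ∑ b, lam b ^ (2 * p) := by
      rw [hU, trace_mul_comm, ← Matrix.mul_assoc, hU2, Matrix.one_mul, trace_diagonal]
    have h2 : lam a ^ (2 * p) ≤ t ^ (2 * p) := by
      refine le_trans ?_ (htr ▸ h)
      exact Finset.single_le_sum (f := fun b => lam b ^ (2 * p))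
        (fun b _ => by rw [pow_mul]; positivity) (Finset.mem_univ a)
    rw [pow_mul, pow_mul] at h2
    exact le_of_pow_le_pow_left₀ hp (sq_nonneg t) h2
  have hsq : ∀ w : ι → ℝ, ∑ i, w i ^ 2 = w ⬝ᵥ w := fun w => by
    simp [dotProduct, sq]
  have hXt : Xᵀ = X := by rw [← conjTranspose_eq_transpose_of_trivial]; exact hX
  have e1 : ∑ i, (X *ᵥ u) i ^ 2 = ∑ a, lam a ^ 2 * (Uᵀ *ᵥ u) a ^ 2 := by
    have hstep : (X *ᵥ u) ⬝ᵥ (X *ᵥ u) = u ⬝ᵥ ((X ^ 2) *ᵥ u) := by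
      rw [sq, ← mulVec_mulVec, dotProduct_mulVec u, ← mulVec_transpose, hXt]
    rw [hsq, hstep, hU, ← mulVec_mulVec, ← mulVec_mulVec, dotProduct_mulVec, ← mulVec_transpose]
    refine Finset.sum_congr rfl fun a _ => ?_
    rw [mulVec_diagonal]; ring
  have e2 : ∑ i, u i ^ 2 = ∑ a, (Uᵀ *ᵥ u) a ^ 2 := by
    rw [hsq, hsq, dotProduct_mulVec, ← mulVec_transpose, transpose_transpose, mulVec_mulVec, hU1,
      one_mulVec]
  rw [e1, e2, Finset.mul_sum]
  exact Finset.sum_le_sum fun a _ => mul_le_mul_of_nonneg_right (hlam a) (sq_nonneg _)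

theorem exists_orthonormal_factor {m l : Type*} [Fintype m] [Fintype l] [DecidableEq m]
    [DecidableEq l] (T : Matrix m l ℝ) :
    ∃ U : Matrix m (Fin T.rank) ℝ, Uᵀ * U = 1 ∧ U * (Uᵀ * T) = T := by
  have h : Module.finrank ℝ (LinearMap.range (Matrix.toEuclideanLin T)) = T.rank := by
    rw [Matrix.rank_eq_finrank_range_toLin T (PiLp.basisFun 2 ℝ m) (PiLp.basisFun 2 ℝ l)]
    rw [← Matrix.toLpLin_eq_toLin]
  let b := (stdOrthonormalBasis ℝ (LinearMap.range (Matrix.toEuclideanLin T))).reindex (finCongr h)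
  refine ⟨Matrix.of fun i s => (b s : EuclideanSpace ℝ m) i, ?_, ?_⟩
  · ext s t
    have h1 := orthonormal_iff_ite.mp b.orthonormal s t
    rw [Submodule.coe_inner, PiLp.inner_apply] at h1
    simp only [Matrix.mul_apply, Matrix.transpose_apply, Matrix.one_apply, Matrix.of_apply]
    rw [← h1]
    simp [mul_comm]
  · ext i j
    have hv : Matrix.toEuclideanLin T (EuclideanSpace.single j 1) ∈
        LinearMap.range (Matrix.toEuclideanLin T) := ⟨_, rfl⟩
    have h2 := b.sum_repr' ⟨_, hv⟩
    have h3 := congrArg (fun x : LinearMap.range (Matrix.toEuclideanLin T) =>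
      (x : EuclideanSpace ℝ m) i) h2
    simp only [Submodule.coe_sum, Submodule.coe_smul, Submodule.coe_inner, PiLp.inner_apply] at h3
    have h4 : ∀ i, (Matrix.toEuclideanLin T (EuclideanSpace.single j 1)) i = T i j := by
      intro i; simp [Matrix.toEuclideanLin, Matrix.toLpLin_apply]
    simp only [h4] at h3
    rw [← h3]
    simp [Matrix.mul_apply, WithLp.ofLp_sum, mul_comm]

/-- If every `x`-direction increase of a determinant is dominated by `(1 + τ) ^ r`, then `x ≤ r`. -/
theorem le_of_forall_one_add_mul_le_pow {x : ℝ} {r : ℕ}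
    (h : ∀ τ : ℝ, 0 < τ → 1 + τ * x ≤ (1 + τ) ^ r) : x ≤ r := by
  by_contra hx
  push Not at hx
  have h1 : HasDerivAt (fun τ : ℝ => (1 + τ) ^ r - (1 + τ * x)) (r - x) 0 := by
    have h2 : HasDerivAt (fun τ : ℝ => (1 + τ) ^ r) (r * (1 + 0) ^ (r - 1) * 1) (0:ℝ) :=
      (((hasDerivAt_id (0:ℝ)).const_add 1).pow r)
    have h3 : HasDerivAt (fun τ : ℝ => (1 + τ * x)) (1 * x) (0:ℝ) :=
      (((hasDerivAt_id (0:ℝ)).mul_const x).const_add 1)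
    have h4 := h2.sub h3
    have e : (r:ℝ) * (1 + 0) ^ (r - 1) * 1 - 1 * x = r - x := by simp
    rw [e] at h4
    exact h4
  have h4 := h1.tendsto_slope_zero_right
  have h5 : 0 ≤ (r : ℝ) - x := by
    refine ge_of_tendsto h4 ?_
    filter_upwards [self_mem_nhdsWithin] with t ht
    have := h t ht
    have e : t⁻¹ • ((1 + (0 + t)) ^ r - (1 + (0 + t) * x) - ((1 + 0) ^ r - (1 + 0 * x)))
        = t⁻¹ * ((1 + t) ^ r - (1 + t * x)) := by simp
    rw [e]
    exact mul_nonneg (inv_nonneg.mpr (le_of_lt ht)) (by linarith)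
  linarith

theorem transpose_mul_diagonal_mul_apply {m l : Type*} [Fintype m] [DecidableEq m]
    (U : Matrix m l ℝ) (v : m → ℝ) (a b : l) :
    (Uᵀ * diagonal v * U) a b = ∑ j, U j a * v j * U j b := by
  rw [Matrix.mul_apply]
  simp only [Matrix.mul_diagonal, Matrix.transpose_apply]

theorem exists_design {m : Type*} [Fintype m] [DecidableEq m] {r : ℕ} (U : Matrix m (Fin r) ℝ)
    (hU : Uᵀ * U = 1) [Nonempty m] :
    ∃ π : m → ℝ, (∀ i, 0 ≤ π i) ∧ ∑ i, π i = 1 ∧ (Uᵀ * diagonal π * U).det ≠ 0 ∧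
      ∀ i, U i ⬝ᵥ ((Uᵀ * diagonal π * U)⁻¹ *ᵥ U i) ≤ r := by
  let f : (m → ℝ) → ℝ := fun π => (Uᵀ * diagonal π * U).det
  have hf : Continuous f := by
    refine Continuous.matrix_det ?_
    fun_prop
  have hne : (stdSimplex ℝ m).Nonempty := ⟨_, single_mem_stdSimplex ℝ (Classical.arbitrary m)⟩
  obtain ⟨π, hπ, hmax⟩ := (isCompact_stdSimplex ℝ m).exists_isMaxOn hne hf.continuousOn
  have hpos : 0 < f π := by
    have hc : (0:ℝ) < Fintype.card m := by exact_mod_cast Fintype.card_pos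
    have hu : (fun _ : m => (Fintype.card m : ℝ)⁻¹) ∈ stdSimplex ℝ m := by
      refine ⟨fun _ => by positivity, ?_⟩
      simp [hc.ne']
    refine lt_of_lt_of_le ?_ (hmax hu)
    have : Uᵀ * diagonal (fun _ : m => (Fintype.card m : ℝ)⁻¹) * U
        = (Fintype.card m : ℝ)⁻¹ • (1 : Matrix (Fin r) (Fin r) ℝ) := by
      rw [← hU, ← Matrix.smul_one_eq_diagonal]
      simp
    change 0 < (_ : Matrix (Fin r) (Fin r) ℝ).det
    rw [this, Matrix.det_smul, Matrix.det_one]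
    positivity
  refine ⟨π, hπ.1, hπ.2, hpos.ne', fun i => ?_⟩
  refine le_of_forall_one_add_mul_le_pow fun τ hτ => ?_
  set G := Uᵀ * diagonal π * U with hG
  have hτ1 : 0 < 1 + τ := by linarith
  have h1 : (1 + τ)⁻¹ • (π + τ • Pi.single i 1) ∈ stdSimplex ℝ m := by
    refine ⟨fun j => ?_, ?_⟩
    · have := hπ.1 j
      have h3 : (0:ℝ) ≤ (Pi.single i 1 : m → ℝ) j := by
        rw [Pi.single_apply]; split_ifs <;> norm_num
      simp only [Pi.smul_apply, Pi.add_apply, smul_eq_mul]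
      positivity
    · have := hπ.2
      simp only [Pi.smul_apply, Pi.add_apply, smul_eq_mul, ← Finset.mul_sum, Finset.sum_add_distrib,
        this, Finset.sum_pi_single', Finset.mem_univ, if_true]
      simp [hτ1.ne']
  have h2 : f ((1 + τ)⁻¹ • (π + τ • Pi.single i 1)) ≤ f π := hmax h1
  have h3 : Uᵀ * diagonal ((1 + τ)⁻¹ • (π + τ • Pi.single i (1:ℝ))) * U
      = (1 + τ)⁻¹ • (G + replicateCol Unit (τ • U i) * replicateRow Unit (U i)) := by
    ext a b
    rw [Matrix.smul_apply, Matrix.add_apply, hG, transpose_mul_diagonal_mul_apply,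
      transpose_mul_diagonal_mul_apply]
    simp only [Pi.add_apply,
      Matrix.mul_apply, Pi.smul_apply, smul_eq_mul, replicateCol_apply,
      replicateRow_apply, Finset.univ_unique, Finset.sum_singleton]
    have : ∑ j, U j a * ((1 + τ)⁻¹ * (π j + τ * (Pi.single i 1 : m → ℝ) j)) * U j b
      = (1 + τ)⁻¹ * (∑ j, U j a * π j * U j b + ∑ j, (Pi.single i 1 : m → ℝ) j * (τ * (U j a * U j b))) := by
      rw [← Finset.sum_add_distrib, Finset.mul_sum]
      refine Finset.sum_congr rfl fun j _ => by ring
    refine this.trans ?_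
    congr 2
    rw [Finset.sum_eq_single i]
    · simp; ring
    · intro j _ hj; simp [hj]
    · simp
  have h4 : f ((1 + τ)⁻¹ • (π + τ • Pi.single i 1)) = ((1 + τ)⁻¹) ^ r *
      (f π * (1 + τ * (U i ⬝ᵥ (G⁻¹ *ᵥ U i)))) := by
    simp only [f]
    rw [h3, Matrix.det_smul, Matrix.det_add_replicateCol_mul_replicateRow (isUnit_iff_ne_zero.mpr hpos.ne'),
      Fintype.card_fin]
    congr 3
    simp only [Matrix.det_unique, Matrix.add_apply, Matrix.one_apply_eq]
    congr 1
    rw [Matrix.mul_assoc, ← Matrix.replicateCol_mulVec]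
    simp only [Matrix.mul_apply, replicateCol_apply, replicateRow_apply, dotProduct,
      Matrix.mulVec_smul, Pi.smul_apply, smul_eq_mul, Finset.mul_sum]
    refine Finset.sum_congr rfl fun j _ => by ring
  rw [h4, inv_pow, inv_mul_le_iff₀ (by positivity)] at h2
  nlinarith

theorem exists_bounded_factor {m l : Type*} [Fintype m] [Fintype l] [DecidableEq m]
    [DecidableEq l] (T : Matrix m l ℝ) {β : ℝ} (hT : ∀ i j, |T i j| ≤ β) :
    ∃ (X : Matrix m (Fin T.rank) ℝ) (Y : Matrix (Fin T.rank) l ℝ), T = X * Y ∧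
      (∀ i, ∑ s, X i s ^ 2 ≤ T.rank) ∧ ∀ j, ∑ s, Y s j ^ 2 ≤ β ^ 2 := by
  cases isEmpty_or_nonempty m with
  | inl hm =>
    refine ⟨0, 0, Matrix.ext fun i => (hm.false i).elim, fun i => (hm.false i).elim, fun j => ?_⟩
    simpa using sq_nonneg β
  | inr hm =>
    obtain ⟨U, hU, hUT⟩ := exists_orthonormal_factor T
    obtain ⟨π, hπ0, hπ1, hdet, hx⟩ := exists_design U hU
    set G := Uᵀ * diagonal π * U with hG
    have hGs : G.IsHermitian := by
      rw [Matrix.IsHermitian, conjTranspose_eq_transpose_of_trivial, hG]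
      simp [Matrix.mul_assoc]
    obtain ⟨Q, lam, hQ1, hQ2, hpow⟩ := exists_spectral_pow hGs
    have hGe : G = Q * diagonal lam * Qᵀ := by simpa using hpow 1
    have hd : (U * Q)ᵀ * diagonal π * (U * Q) = diagonal lam := by
      calc _ = Qᵀ * G * Q := by simp only [hG, transpose_mul, Matrix.mul_assoc]
        _ = (Qᵀ * Q) * diagonal lam * (Qᵀ * Q) := by
          conv_lhs => rw [hGe]
          simp only [Matrix.mul_assoc]
        _ = _ := by simp [hQ2]
    have hlam : ∀ s, 0 < lam s := by
      intro s
      have h0 : 0 ≤ lam s := by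
        have := congrFun (congrFun hd s) s
        rw [transpose_mul_diagonal_mul_apply, diagonal_apply_eq] at this
        rw [← this]
        exact Finset.sum_nonneg fun j _ => by nlinarith [hπ0 j, mul_nonneg (hπ0 j) (sq_nonneg ((U*Q) j s))]
      refine lt_of_le_of_ne h0 fun h => hdet ?_
      rw [hGe, det_mul, det_mul, det_diagonal, Finset.prod_eq_zero (Finset.mem_univ s) h.symm]
      simp
    have hinv : G⁻¹ = Q * diagonal (fun s => (lam s)⁻¹) * Qᵀ := by
      refine Matrix.inv_eq_left_inv ?_
      calc _ = Q * diagonal (fun s => (lam s)⁻¹) * (Qᵀ * Q) * diagonal lam * Qᵀ := by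
            conv_lhs => rw [hGe]
            simp only [Matrix.mul_assoc]
        _ = Q * (diagonal (fun s => (lam s)⁻¹) * diagonal lam) * Qᵀ := by
            simp [hQ2, Matrix.mul_assoc]
        _ = 1 := by
            rw [diagonal_mul_diagonal]
            simp [(hlam _).ne', hQ1]
    refine ⟨(U * Q) * diagonal (fun s => (√(lam s))⁻¹),
      diagonal (fun s => √(lam s)) * (Qᵀ * (Uᵀ * T)), ?_, fun i => ?_, fun j => ?_⟩
    · have : diagonal (fun s => (√(lam s))⁻¹) * diagonal (fun s => √(lam s))
          = (1 : Matrix (Fin T.rank) (Fin T.rank) ℝ) := by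
        rw [diagonal_mul_diagonal]
        simp [(Real.sqrt_pos.mpr (hlam _)).ne']
      calc T = U * ((Q * Qᵀ) * (Uᵀ * T)) := by rw [hQ1, Matrix.one_mul, hUT]
        _ = U * Q * (diagonal (fun s => (√(lam s))⁻¹) * diagonal (fun s => √(lam s)))
            * (Qᵀ * (Uᵀ * T)) := by
          rw [this]; simp only [Matrix.mul_assoc, Matrix.one_mul]
        _ = _ := by simp only [Matrix.mul_assoc]
    · refine le_trans (le_of_eq ?_) (hx i)
      rw [hinv, ← mulVec_mulVec, ← mulVec_mulVec, dotProduct_mulVec]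
      have e : U i ᵥ* Q = Qᵀ *ᵥ U i := by rw [mulVec_transpose]
      rw [e]
      simp only [dotProduct, mulVec_diagonal, mul_diagonal]
      refine Finset.sum_congr rfl fun s _ => ?_
      have e2 : (U * Q) i s = (Qᵀ *ᵥ U i) s := by rw [mulVec_transpose]; rfl
      rw [e2, mul_pow, inv_pow, Real.sq_sqrt (hlam s).le]
      ring
    · have h1 : ∑ s, (diagonal (fun s => √(lam s)) * (Qᵀ * (Uᵀ * T))) s j ^ 2
          = ((Qᵀ * (Uᵀ * T))ᵀ * diagonal lam * (Qᵀ * (Uᵀ * T))) j j := by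
        rw [transpose_mul_diagonal_mul_apply]
        refine Finset.sum_congr rfl fun s _ => ?_
        rw [diagonal_mul, mul_pow, Real.sq_sqrt (hlam s).le]; ring
      have h2 : (Qᵀ * (Uᵀ * T))ᵀ * diagonal lam * (Qᵀ * (Uᵀ * T)) = Tᵀ * diagonal π * T := by
        rw [← hd]
        calc _ = (U * (((Q * Qᵀ)) * (Uᵀ * T)))ᵀ * diagonal π * (U * ((Q * Qᵀ) * (Uᵀ * T))) := by
              simp only [transpose_mul, transpose_transpose, Matrix.mul_assoc]
          _ = _ := by rw [hQ1, Matrix.one_mul, hUT]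
      rw [h1, h2, transpose_mul_diagonal_mul_apply]
      calc ∑ i, T i j * π i * T i j ≤ ∑ i, β ^ 2 * π i := by
            refine Finset.sum_le_sum fun i _ => ?_
            have := sq_le_sq' (by linarith [abs_nonneg (T i j), hT i j]) (hT i j)
            rw [sq_abs] at this
            nlinarith [hπ0 i]
        _ = β ^ 2 := by rw [← Finset.mul_sum, hπ1, mul_one]

theorem sum_hadamard_mulVec_sq_le {m l : Type*} [Fintype m] [Fintype l] [DecidableEq m]
    [DecidableEq l] (A T : Matrix m l ℝ) {β a : ℝ} (hT : ∀ i j, |T i j| ≤ β) (ha : 0 ≤ a)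
    (hA : ∀ y : l → ℝ, ∑ i, (A *ᵥ y) i ^ 2 ≤ a * ∑ j, y j ^ 2) (y : l → ℝ) :
    ∑ i, ((Matrix.of fun i j => A i j * T i j) *ᵥ y) i ^ 2
      ≤ T.rank * β ^ 2 * a * ∑ j, y j ^ 2 := by
  obtain ⟨X, Y, hXY, hX, hY⟩ := exists_bounded_factor T hT
  have h1 : ∀ i, ((Matrix.of fun i j => A i j * T i j) *ᵥ y) i
      = ∑ s, X i s * (A *ᵥ (fun j => y j * Y s j)) i := by
    intro i
    simp only [mulVec, dotProduct, Matrix.of_apply]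
    have : ∀ j, T i j = ∑ s, X i s * Y s j := fun j => by
      conv_lhs => rw [hXY]
      rw [Matrix.mul_apply]
    simp only [this, Finset.mul_sum, Finset.sum_mul]
    rw [Finset.sum_comm]
    refine Finset.sum_congr rfl fun s _ => Finset.sum_congr rfl fun j _ => by ring
  calc _ ≤ ∑ i, (T.rank : ℝ) * ∑ s, (A *ᵥ (fun j => y j * Y s j)) i ^ 2 := by
        refine Finset.sum_le_sum fun i _ => ?_
        rw [h1]
        refine (Finset.sum_mul_sq_le_sq_mul_sq _ _ _).trans ?_
        exact mul_le_mul_of_nonneg_right (hX i) (Finset.sum_nonneg fun _ _ => sq_nonneg _)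
    _ = T.rank * ∑ s, ∑ i, (A *ᵥ (fun j => y j * Y s j)) i ^ 2 := by
        rw [← Finset.mul_sum, Finset.sum_comm]
    _ ≤ T.rank * ∑ s, a * ∑ j, (y j * Y s j) ^ 2 := by
        gcongr with s _
        exact hA _
    _ = T.rank * (a * ∑ j, y j ^ 2 * ∑ s, Y s j ^ 2) := by
        rw [← Finset.mul_sum, Finset.sum_comm]
        simp only [mul_pow, Finset.mul_sum]
    _ ≤ T.rank * (a * ∑ j, y j ^ 2 * β ^ 2) := by
        gcongr with j _
        exact hY j
    _ = _ := by rw [← Finset.sum_mul]; ring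

theorem specNorm_le_iff {m l : Type*} [Fintype m] [Fintype l] [DecidableEq l]
    (M : Matrix m l ℝ) {c : ℝ} (hc : 0 ≤ c) :
    specNorm M ≤ c ↔ ∀ y : l → ℝ, ∑ i, (M *ᵥ y) i ^ 2 ≤ c ^ 2 * ∑ j, y j ^ 2 := by
  unfold specNorm
  rw [ContinuousLinearMap.opNorm_le_iff hc]
  have key : ∀ y : l → ℝ, ‖LinearMap.toContinuousLinearMap (Matrix.toEuclideanLin M) (WithLp.toLp 2 y)‖
      ≤ c * ‖WithLp.toLp 2 y‖ ↔ ∑ i, (M *ᵥ y) i ^ 2 ≤ c ^ 2 * ∑ j, y j ^ 2 := by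
    intro y
    rw [← abs_of_nonneg (norm_nonneg _), ← abs_of_nonneg (mul_nonneg hc (norm_nonneg _)), ← sq_le_sq,
      mul_pow, EuclideanSpace.norm_sq_eq, EuclideanSpace.norm_sq_eq]
    simp [Matrix.toEuclideanLin, Matrix.toLpLin_apply]
  constructor
  · intro h y; exact (key y).mp (h _)
  · intro h x; exact (key x.ofLp).mpr (h _)

theorem specNorm_nonneg {m l : Type*} [Fintype m] [Fintype l] [DecidableEq l]
    (M : Matrix m l ℝ) : 0 ≤ specNorm M := norm_nonneg _

theorem sum_mulVec_sq_le_specNorm {m l : Type*} [Fintype m] [Fintype l] [DecidableEq l]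
    (M : Matrix m l ℝ) (y : l → ℝ) :
    ∑ i, (M *ᵥ y) i ^ 2 ≤ specNorm M ^ 2 * ∑ j, y j ^ 2 :=
  (specNorm_le_iff M (specNorm_nonneg M)).mp le_rfl y

theorem specNorm_add_le {m l : Type*} [Fintype m] [Fintype l] [DecidableEq l]
    (M N : Matrix m l ℝ) : specNorm (M + N) ≤ specNorm M + specNorm N := by
  unfold specNorm
  rw [map_add, map_add]
  exact norm_add_le _ _

theorem specNorm_neg {m l : Type*} [Fintype m] [Fintype l] [DecidableEq l]
    (M : Matrix m l ℝ) : specNorm (-M) = specNorm M := by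
  unfold specNorm
  rw [map_neg, map_neg, norm_neg]

theorem specNorm_transpose_le {m l : Type*} [Fintype m] [Fintype l] [DecidableEq l] [DecidableEq m]
    (M : Matrix m l ℝ) : specNorm Mᵀ ≤ specNorm M := by
  rw [specNorm_le_iff _ (specNorm_nonneg M)]
  intro x
  set y := Mᵀ *ᵥ x
  have h1 : ∑ i, y i ^ 2 = ∑ j, x j * (M *ᵥ y) j := by
    have : y ⬝ᵥ y = x ⬝ᵥ (M *ᵥ y) := by
      rw [dotProduct_mulVec x M y, ← mulVec_transpose]
    simpa [dotProduct, sq] using this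
  have h2 : (∑ i, y i ^ 2) ^ 2 ≤ (∑ j, x j ^ 2) * ∑ j, (M *ᵥ y) j ^ 2 := by
    rw [h1]; exact Finset.sum_mul_sq_le_sq_mul_sq _ _ _
  have h3 := sum_mulVec_sq_le_specNorm M y
  have h4 : 0 ≤ ∑ j, x j ^ 2 := Finset.sum_nonneg fun _ _ => sq_nonneg _
  have h5 : 0 ≤ ∑ j, y j ^ 2 := Finset.sum_nonneg fun _ _ => sq_nonneg _
  rcases h5.eq_or_lt with h | h
  · rw [← h]; positivity
  · have h6 : (∑ i, y i ^ 2) ^ 2 ≤ (∑ j, x j ^ 2) * (specNorm M ^ 2 * ∑ j, y j ^ 2) :=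
      h2.trans (mul_le_mul_of_nonneg_left h3 h4)
    have h7 : (∑ i, y i ^ 2) * (∑ i, y i ^ 2) ≤ (specNorm M ^ 2 * ∑ j, x j ^ 2) * ∑ i, y i ^ 2 := by
      nlinarith
    exact le_of_mul_le_mul_right h7 h

theorem sum_sq_eq_trace {m l : Type*} [Fintype m] [Fintype l] (N : Matrix m l ℝ) :
    ∑ i, ∑ j, N i j ^ 2 = trace (Nᵀ * N) := by
  rw [trace, Finset.sum_comm]
  simp [Matrix.mul_apply, sq]

/-- The squared Frobenius norm is at most the rank times the squared spectral norm. -/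
theorem sum_sq_le_rank_mul_specNorm_sq {m l : Type*} [Fintype m] [Fintype l] [DecidableEq m]
    [DecidableEq l] (M : Matrix m l ℝ) :
    ∑ i, ∑ j, M i j ^ 2 ≤ M.rank * specNorm M ^ 2 := by
  obtain ⟨U, hU, hUM⟩ := exists_orthonormal_factor M
  have h1 : ∑ i, ∑ j, M i j ^ 2 = ∑ s, ∑ j, (Uᵀ * M) s j ^ 2 := by
    rw [sum_sq_eq_trace, sum_sq_eq_trace, transpose_mul, transpose_transpose, Matrix.mul_assoc, hUM]
  rw [h1]
  have h2 : ∀ s, ∑ j, (Uᵀ * M) s j ^ 2 ≤ specNorm M ^ 2 := by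
    intro s
    have h3 := sum_mulVec_sq_le_specNorm Mᵀ (fun i => U i s)
    have h4 : ∑ i, U i s ^ 2 = 1 := by
      have := congrFun (congrFun hU s) s
      rw [Matrix.mul_apply, Matrix.one_apply_eq] at this
      simpa [sq] using this
    rw [h4, mul_one] at h3
    have h5 : ∀ j, (Mᵀ *ᵥ (fun i => U i s)) j = (Uᵀ * M) s j := by
      intro j
      simp [mulVec, dotProduct, Matrix.mul_apply, mul_comm]
    simp only [h5] at h3
    exact h3.trans (pow_le_pow_left₀ (specNorm_nonneg _) (specNorm_transpose_le M) 2)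
  calc _ ≤ ∑ _s : Fin M.rank, specNorm M ^ 2 := Finset.sum_le_sum fun s _ => h2 s
    _ = _ := by simp

theorem embed_eq_piSplitAt_symm (k : Fin n) (a : Fin (d k)) (b : RestIdx d k) :
    embed k a b = (Equiv.piSplitAt k (fun j => Fin (d j))).symm (a, b) := by
  funext j
  by_cases h : j = k
  · subst h
    simp [embed, Equiv.piSplitAt]
  · simp [embed, Equiv.piSplitAt, h]

theorem sum_embed (k : Fin n) (f : Index d → ℝ) :
    ∑ a, ∑ b, f (embed k a b) = ∑ i, f i := by
  rw [← (Equiv.piSplitAt k (fun j => Fin (d j))).symm.sum_comp, Fintype.sum_prod_type]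
  simp only [embed_eq_piSplitAt_symm]

theorem embed_self (k : Fin n) (a : Fin (d k)) (b : RestIdx d k) : embed k a b k = a := by
  simp [embed]

theorem update_embed (k : Fin n) (a s : Fin (d k)) (b : RestIdx d k) :
    Function.update (embed k a b) k s = embed k s b := by
  funext j
  by_cases h : j = k
  · subst h
    simp [embed]
  · simp [embed, h]

theorem frobNorm_eq_norm (X : Tensor d) : frobNorm X = ‖(WithLp.toLp 2 X : EuclideanSpace ℝ (Index d))‖ := by
  rw [EuclideanSpace.norm_eq]
  simp [frobNorm]

theorem frobNorm_add_le (X Y : Tensor d) : frobNorm (X + Y) ≤ frobNorm X + frobNorm Y := by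
  simp only [frobNorm_eq_norm, WithLp.toLp_add]
  exact norm_add_le _ _

theorem frobNorm_nonneg (X : Tensor d) : 0 ≤ frobNorm X := Real.sqrt_nonneg _

theorem frobNorm_sq (X : Tensor d) : frobNorm X ^ 2 = ∑ i, X i ^ 2 :=
  Real.sq_sqrt (Finset.sum_nonneg fun _ _ => sq_nonneg _)

theorem frobNorm_sq_eq_matricize (k : Fin n) (X : Tensor d) :
    frobNorm X ^ 2 = ∑ a, ∑ b, matricize k X a b ^ 2 := by
  rw [frobNorm_sq, ← sum_embed k]
  rfl

theorem matricize_modeProd (k : Fin n) (X : Tensor d) (A : Matrix (Fin (d k)) (Fin (d k)) ℝ) :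
    matricize k (modeProd k X A) = A * matricize k X := by
  ext a b
  simp only [matricize, modeProd, Matrix.mul_apply, embed_self, update_embed]

theorem modeProd_sub (k : Fin n) (X Y : Tensor d) (A : Matrix (Fin (d k)) (Fin (d k)) ℝ) :
    modeProd k (X - Y) A = modeProd k X A - modeProd k Y A := by
  funext i
  simp [modeProd, mul_sub, Finset.sum_sub_distrib]

section Projection

variable {m s l : Type*} [Fintype m] [DecidableEq m] [Fintype s] [DecidableEq s]
  [Fintype l] [DecidableEq l]

theorem sum_sq_projection_add (U : Matrix m s ℝ) (hU : Uᵀ * U = 1) (N : Matrix m l ℝ) :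
    ∑ i, ∑ j, N i j ^ 2 = ∑ i, ∑ j, (U * Uᵀ * N) i j ^ 2
      + ∑ i, ∑ j, (N - U * Uᵀ * N) i j ^ 2 := by
  have e : (U * Uᵀ) * (U * Uᵀ) = U * Uᵀ := by
    rw [Matrix.mul_assoc, ← Matrix.mul_assoc Uᵀ, hU, Matrix.one_mul]
  have t : (U * Uᵀ)ᵀ = U * Uᵀ := by simp
  have e' : U * (Uᵀ * (U * Uᵀ)) = U * Uᵀ := by rw [← Matrix.mul_assoc, e]
  have e2 : (U * Uᵀ * N)ᵀ * (U * Uᵀ * N) = Nᵀ * (U * Uᵀ * N) := by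
    rw [transpose_mul, t, Matrix.mul_assoc, ← Matrix.mul_assoc (U * Uᵀ), e]
  have e3 : (U * Uᵀ * N)ᵀ * N = Nᵀ * (U * Uᵀ * N) := by
    rw [transpose_mul, t, Matrix.mul_assoc]
  rw [sum_sq_eq_trace, sum_sq_eq_trace, sum_sq_eq_trace, ← trace_add]
  congr 1
  rw [transpose_sub, Matrix.sub_mul, Matrix.mul_sub, Matrix.mul_sub, e2, e3]
  abel

theorem sum_mulVec_sq_eq_sum_replicateCol (N : Matrix m l ℝ) (y : l → ℝ) :
    ∑ i, (N *ᵥ y) i ^ 2 = ∑ i, ∑ j, (N * replicateCol Unit y) i j ^ 2 := by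
  simp [← replicateCol_mulVec]

theorem specNorm_projection_mul_le (U : Matrix m s ℝ) (hU : Uᵀ * U = 1) (N : Matrix m l ℝ) :
    specNorm (U * Uᵀ * N) ≤ specNorm N := by
  rw [specNorm_le_iff _ (specNorm_nonneg N)]
  intro y
  refine le_trans ?_ (sum_mulVec_sq_le_specNorm N y)
  rw [sum_mulVec_sq_eq_sum_replicateCol, sum_mulVec_sq_eq_sum_replicateCol N,
    sum_sq_projection_add U hU (N * _), Matrix.mul_assoc]
  exact le_add_of_nonneg_right (Finset.sum_nonneg fun _ _ => Finset.sum_nonneg fun _ _ => sq_nonneg _)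

theorem specNorm_sub_projection_mul_le (U : Matrix m s ℝ) (hU : Uᵀ * U = 1) (N : Matrix m l ℝ) :
    specNorm (N - U * Uᵀ * N) ≤ specNorm N := by
  rw [specNorm_le_iff _ (specNorm_nonneg N)]
  intro y
  refine le_trans ?_ (sum_mulVec_sq_le_specNorm N y)
  rw [sum_mulVec_sq_eq_sum_replicateCol, sum_mulVec_sq_eq_sum_replicateCol N,
    sum_sq_projection_add U hU (N * _), Matrix.sub_mul, Matrix.mul_assoc (U * Uᵀ)]
  exact le_add_of_nonneg_left (Finset.sum_nonneg fun _ _ => Finset.sum_nonneg fun _ _ => sq_nonneg _)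

end Projection

theorem frobNorm_modeProd_projection_le {s : ℕ} (k : Fin n) (X : Tensor d)
    (U : Matrix (Fin (d k)) (Fin s) ℝ) (hU : Uᵀ * U = 1) :
    frobNorm (modeProd k X (U * Uᵀ)) ≤ frobNorm X := by
  refine le_of_sq_le_sq ?_ (frobNorm_nonneg _)
  rw [frobNorm_sq_eq_matricize k, frobNorm_sq_eq_matricize k X, matricize_modeProd,
    sum_sq_projection_add U hU (matricize k X)]
  exact le_add_of_nonneg_right (Finset.sum_nonneg fun _ _ => Finset.sum_nonneg fun _ _ => sq_nonneg _)

section Fold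

variable {r : Fin n → ℕ} (U : ∀ k, Matrix (Fin (d k)) (Fin (r k)) ℝ)

theorem foldl_modeProd_sub (A : ∀ k, Matrix (Fin (d k)) (Fin (d k)) ℝ) (L : List (Fin n))
    (X Y : Tensor d) :
    L.foldl (fun Y k => modeProd k Y (A k)) (X - Y) =
      L.foldl (fun Y k => modeProd k Y (A k)) X - L.foldl (fun Y k => modeProd k Y (A k)) Y := by
  induction L generalizing X Y with
  | nil => rfl
  | cons k L ih => simp only [List.foldl_cons, modeProd_sub, ih]

theorem frobNorm_foldl_le (hU : ∀ k, (U k)ᵀ * U k = 1) (L : List (Fin n)) (X : Tensor d) :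
    frobNorm (L.foldl (fun Y k => modeProd k Y (U k * (U k)ᵀ)) X) ≤ frobNorm X := by
  induction L generalizing X with
  | nil => exact le_rfl
  | cons k L ih => exact (ih _).trans (frobNorm_modeProd_projection_le k X (U k) (hU k))

theorem frobNorm_sub_foldl_le (hU : ∀ k, (U k)ᵀ * U k = 1) (L : List (Fin n)) (X : Tensor d) :
    frobNorm (X - L.foldl (fun Y k => modeProd k Y (U k * (U k)ᵀ)) X) ≤
      (L.map fun k => frobNorm (X - modeProd k X (U k * (U k)ᵀ))).sum := by
  induction L with
  | nil => simp [frobNorm]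
  | cons k L ih =>
    rw [List.foldl_cons, List.map_cons, List.sum_cons]
    have e : X - L.foldl (fun Y k => modeProd k Y (U k * (U k)ᵀ)) (modeProd k X (U k * (U k)ᵀ))
        = L.foldl (fun Y k => modeProd k Y (U k * (U k)ᵀ)) (X - modeProd k X (U k * (U k)ᵀ))
          + (X - L.foldl (fun Y k => modeProd k Y (U k * (U k)ᵀ)) X) := by
      rw [foldl_modeProd_sub]; abel
    rw [e]
    exact (frobNorm_add_le _ _).trans (add_le_add (frobNorm_foldl_le U hU _ _) ih)

theorem frobNorm_foldl_le_sum (hU : ∀ k, (U k)ᵀ * U k = 1) {L : List (Fin n)} (hL : L ≠ [])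
    (X : Tensor d) :
    frobNorm (L.foldl (fun Y k => modeProd k Y (U k * (U k)ᵀ)) X) ≤
      (L.map fun k => frobNorm (modeProd k X (U k * (U k)ᵀ))).sum := by
  cases L with
  | nil => exact absurd rfl hL
  | cons k L =>
    rw [List.foldl_cons, List.map_cons, List.sum_cons]
    refine (frobNorm_foldl_le U hU _ _).trans (le_add_of_nonneg_right (List.sum_nonneg ?_))
    simp only [List.mem_map]
    rintro x ⟨j, -, rfl⟩
    exact frobNorm_nonneg _

theorem frobNorm_le_sqrt_mul_specNorm (k : Fin n) (X : Tensor d) {q : ℕ}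
    (hq : (matricize k X).rank ≤ q) : frobNorm X ≤ √q * specNorm (matricize k X) := by
  refine le_of_sq_le_sq ?_ (mul_nonneg (Real.sqrt_nonneg _) (specNorm_nonneg _))
  rw [frobNorm_sq_eq_matricize k, mul_pow, Real.sq_sqrt (Nat.cast_nonneg _)]
  refine (sum_sq_le_rank_mul_specNorm_sq _).trans ?_
  gcongr

theorem frobNorm_sub_modeProds_le (hn : n ≠ 0) (hU : ∀ k, (U k)ᵀ * U k = 1) (M Y : Tensor d)
    (hM : ∀ k, (matricize k M).rank ≤ r k)
    (hopt : ∀ k, specNorm (matricize k Y - U k * (U k)ᵀ * matricize k Y)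
      ≤ specNorm (matricize k Y - matricize k M)) :
    frobNorm (M - modeProds Y (fun k => U k * (U k)ᵀ)) ≤
      3 * ∑ k, √(r k) * specNorm (matricize k (Y - M)) := by
  have hsub : ∀ k (X Z : Tensor d), matricize k (X - Z) = matricize k X - matricize k Z :=
    fun _ _ _ => rfl
  have e : M - modeProds Y (fun k => U k * (U k)ᵀ)
      = (M - modeProds M (fun k => U k * (U k)ᵀ)) + modeProds (M - Y) (fun k => U k * (U k)ᵀ) := by
    unfold modeProds
    rw [foldl_modeProd_sub]; abel
  have hL : List.finRange n ≠ [] := by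
    simpa [List.finRange_eq_nil_iff] using hn
  have h1 := frobNorm_sub_foldl_le U hU (List.finRange n) M
  have h2 := frobNorm_foldl_le_sum U hU hL (M - Y)
  have hsym : ∀ k, specNorm (matricize k (M - Y)) = specNorm (matricize k (Y - M)) := by
    intro k
    rw [← specNorm_neg]
    congr 1
    rw [hsub, hsub, neg_sub]
  have b1 : ∀ k, frobNorm (M - modeProd k M (U k * (U k)ᵀ)) ≤
      2 * (√(r k) * specNorm (matricize k (Y - M))) := by
    intro k
    have hmat : matricize k (M - modeProd k M (U k * (U k)ᵀ))
        = matricize k M - U k * (U k)ᵀ * matricize k M := by rw [hsub, matricize_modeProd]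
    have hfac : matricize k M - U k * (U k)ᵀ * matricize k M
        = (1 - U k * (U k)ᵀ) * matricize k M := by rw [Matrix.sub_mul, Matrix.one_mul]
    refine (frobNorm_le_sqrt_mul_specNorm k _ (q := r k) ?_).trans ?_
    · rw [hmat, hfac]
      exact (Matrix.rank_mul_le_right _ _).trans (hM k)
    · have h3 : matricize k M - U k * (U k)ᵀ * matricize k M =
          (matricize k Y - U k * (U k)ᵀ * matricize k Y)
          + (matricize k (M - Y) - U k * (U k)ᵀ * matricize k (M - Y)) := by
        rw [hsub, Matrix.mul_sub]; abel
      have h4 := specNorm_sub_projection_mul_le (U k) (hU k) (matricize k (M - Y))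
      have h5 := hopt k
      rw [← hsub] at h5
      rw [hsym] at h4
      have h6 : specNorm (matricize k (M - modeProd k M (U k * (U k)ᵀ)))
          ≤ 2 * specNorm (matricize k (Y - M)) := by
        rw [hmat, h3]
        exact (specNorm_add_le _ _).trans (by linarith)
      calc _ ≤ √(r k) * (2 * specNorm (matricize k (Y - M))) := by gcongr
        _ = _ := by ring
  have b2 : ∀ k, frobNorm (modeProd k (M - Y) (U k * (U k)ᵀ)) ≤
      √(r k) * specNorm (matricize k (Y - M)) := by
    intro k
    refine (frobNorm_le_sqrt_mul_specNorm k _ (q := r k) ?_).trans ?_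
    · rw [matricize_modeProd, Matrix.mul_assoc]
      refine (Matrix.rank_mul_le_left _ _).trans ((Matrix.rank_le_card_width _).trans ?_)
      simp
    · rw [matricize_modeProd]
      gcongr
      rw [← hsym]
      exact specNorm_projection_mul_le (U k) (hU k) _
  rw [e]
  refine (frobNorm_add_le _ _).trans ((add_le_add h1 h2).trans ?_)
  rw [← List.ofFn_eq_map, ← List.ofFn_eq_map, List.sum_ofFn, List.sum_ofFn, ← Finset.sum_add_distrib,
    Finset.mul_sum]
  refine Finset.sum_le_sum fun k _ => ?_
  linarith [b1 k, b2 k]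

end Fold

theorem epow_half (W : Tensor d) (i : Index d) : epow W (1/2) i = √(W i) := by
  rw [epow, Real.sqrt_eq_rpow]

theorem epow_neg_half {W : Tensor d} (hW : ∀ i, 0 < W i) (i : Index d) :
    epow W (-(1/2)) i = (√(W i))⁻¹ := by
  rw [epow, Real.rpow_neg (hW i).le, Real.sqrt_eq_rpow]

theorem outer_embed (w : ∀ j, Fin (d j) → ℝ) (k : Fin n) (a : Fin (d k)) (b : RestIdx d k) :
    outer w (embed k a b) = w k a * ∏ j : {j // j ≠ k}, w j.1 (b j) := by
  rw [outer, Fintype.prod_eq_mul_prod_subtype_ne _ k, embed_self]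
  congr 1
  refine Finset.prod_congr rfl fun j _ => ?_
  simp [embed, j.2]

theorem rank_matricize_sqrt_outer_mul_le (w : ∀ j, Fin (d j) → ℝ) (T : Tensor d)
    (hpos : ∀ i, 0 < outer w i) (k : Fin n) :
    (matricize k (fun i => √(outer w i) * T i)).rank ≤ (matricize k T).rank := by
  have : matricize k (fun i => √(outer w i) * T i) =
      diagonal (fun a => √|w k a|) * matricize k T *
        diagonal (fun b : RestIdx d k => √|∏ j : {j // j ≠ k}, w j.1 (b j)|) := by
    ext a b
    rw [mul_diagonal, diagonal_mul]
    simp only [matricize]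
    have h := hpos (embed k a b)
    rw [← abs_of_pos h, outer_embed, abs_mul, Real.sqrt_mul (abs_nonneg _)]
    ring
  rw [this]
  exact (Matrix.rank_mul_le_left _ _).trans (Matrix.rank_mul_le_right _ _)

theorem frobNorm_weighted_error_le {r : Fin n → ℕ} (w : ∀ j, Fin (d j) → ℝ) {W : Tensor d}
    (hW : W = outer w) (hpos : ∀ i, 0 < W i) (hn : n ≠ 0) (ω : Index d → Bool) {T z That : Tensor d}
    {β : ℝ} (hβ : 0 ≤ β) (hTβ : ∀ i, |T i| ≤ β) (hT : TuckerRankEq T r)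
    (hest : IsHOSVDEstimate W r (fun i => bindic ω i * (T i + z i)) That) {a b : Fin n → ℝ}
    (ha : ∀ k, specNorm (matricize k (fun i => (bindic ω i - W i) / √(W i))) ≤ a k)
    (hb : ∀ k, specNorm (matricize k (fun i => bindic ω i / √(W i) * z i)) ≤ b k) :
    frobNorm (hadamard (epow W (1/2)) (fun i => T i - That i)) ≤
      3 * ∑ k, √(r k) * (√(r k) * β * a k + b k) := by
  obtain ⟨U, hU, hopt, hThat⟩ := hest
  set Y := hadamard (epow W (-(1/2))) (fun i => bindic ω i * (T i + z i)) with hY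
  set M : Tensor d := fun i => √(W i) * T i with hM
  have hrank : ∀ k, (matricize k M).rank ≤ r k := fun k => by
    rw [hM, hW, ← hT k]
    exact rank_matricize_sqrt_outer_mul_le w T (hW ▸ hpos) k
  have hs : ∀ i, 0 < √(W i) := fun i => Real.sqrt_pos.mpr (hpos i)
  have hdiff : hadamard (epow W (1/2)) (fun i => T i - That i)
      = M - modeProds Y (fun k => U k * (U k)ᵀ) := by
    funext i
    rw [hThat]
    simp only [hadamard, epow_half, epow_neg_half hpos, Pi.sub_apply, hM]
    rw [mul_sub, ← mul_assoc, mul_inv_cancel₀ (hs i).ne', one_mul]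
  rw [hdiff]
  refine (frobNorm_sub_modeProds_le U hn hU M Y hrank fun k => hopt k _ (hrank k)).trans ?_
  gcongr with k _
  have hsplit : matricize k (Y - M) =
      (Matrix.of fun i j => matricize k (fun i => (bindic ω i - W i) / √(W i)) i j * matricize k T i j)
        + matricize k (fun i => bindic ω i / √(W i) * z i) := by
    ext i j
    simp only [matricize, Matrix.add_apply, Matrix.of_apply, Pi.sub_apply, hY, hM, hadamard,
      epow_neg_half hpos]
    have := hs (embed k i j)
    have h2 := Real.mul_self_sqrt (hpos (embed k i j)).le
    field_simp
    rw [sq, h2]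
    ring
  rw [hsplit]
  refine (specNorm_add_le _ _).trans (add_le_add ?_ (hb k))
  have ha0 : 0 ≤ a k := (specNorm_nonneg _).trans (ha k)
  rw [specNorm_le_iff _ (by positivity)]
  intro y
  refine (sum_hadamard_mulVec_sq_le _ (matricize k T) (fun i j => hTβ _) (sq_nonneg (a k))
    ((specNorm_le_iff _ ha0).mp (ha k)) y).trans (le_of_eq ?_)
  rw [mul_pow, mul_pow, Real.sq_sqrt (Nat.cast_nonneg _), hT k]

section Moments

variable {Ω₀ : Type*} [MeasurableSpace Ω₀] {P : Measure Ω₀}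

/-- All moments of `f` are finite. -/
def HasAllMoments (f : Ω₀ → ℝ) (P : Measure Ω₀) : Prop := ∀ p : ℕ, MemLp f p P

theorem HasAllMoments.integrable {f : Ω₀ → ℝ} (hf : HasAllMoments f P) : Integrable f P :=
  memLp_one_iff_integrable.mp (by simpa using hf 1)

theorem HasAllMoments.add {f g : Ω₀ → ℝ} (hf : HasAllMoments f P) (hg : HasAllMoments g P) :
    HasAllMoments (fun ω => f ω + g ω) P := fun p => (hf p).add (hg p)

theorem HasAllMoments.sub {f g : Ω₀ → ℝ} (hf : HasAllMoments f P) (hg : HasAllMoments g P) :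
    HasAllMoments (fun ω => f ω - g ω) P := fun p => (hf p).sub (hg p)

theorem HasAllMoments.const [IsProbabilityMeasure P] (c : ℝ) : HasAllMoments (fun _ => c) P := fun _ => memLp_const c

theorem HasAllMoments.mul {f g : Ω₀ → ℝ} (hf : HasAllMoments f P) (hg : HasAllMoments g P) :
    HasAllMoments (fun ω => f ω * g ω) P := by
  intro p
  have : ENNReal.HolderTriple ((2 * p : ℕ) : ℝ≥0∞) ((2 * p : ℕ) : ℝ≥0∞) (p : ℝ≥0∞) := by
    constructor
    push_cast
    rw [ENNReal.mul_inv (by simp) (by simp), ← add_mul, ENNReal.inv_two_add_inv_two, one_mul]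
  exact MemLp.mul (hg (2 * p)) (hf (2 * p))

theorem HasAllMoments.sum {ι : Type*} (s : Finset ι) {f : ι → Ω₀ → ℝ}
    (hf : ∀ i ∈ s, HasAllMoments (f i) P) : HasAllMoments (fun ω => ∑ i ∈ s, f i ω) P :=
  fun p => memLp_finsetSum s fun i hi => hf i hi p

theorem HasAllMoments.pow [IsProbabilityMeasure P] {f : Ω₀ → ℝ} (hf : HasAllMoments f P) (q : ℕ) :
    HasAllMoments (fun ω => f ω ^ q) P := by
  induction q with
  | zero => simpa using HasAllMoments.const 1
  | succ q ih => simpa only [pow_succ] using ih.mul hf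

theorem HasAllMoments.comp {Ω₁ : Type*} [MeasurableSpace Ω₁] {Q : Measure Ω₁} {f : Ω₁ → ℝ}
    (hf : HasAllMoments f Q) {φ : Ω₀ → Ω₁} (hφ : MeasurePreserving φ P Q) :
    HasAllMoments (fun ω => f (φ ω)) P :=
  fun p => (hf p).comp_measurePreserving hφ

theorem hasAllMoments_matrix_mul {a b c : Type*} [Fintype b]
    {M : Ω₀ → Matrix a b ℝ} {N : Ω₀ → Matrix b c ℝ}
    (hM : ∀ i j, HasAllMoments (fun ω => M ω i j) P) (hN : ∀ i j, HasAllMoments (fun ω => N ω i j) P)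
    (i : a) (j : c) : HasAllMoments (fun ω => (M ω * N ω) i j) P := by
  simp only [Matrix.mul_apply]
  exact HasAllMoments.sum _ fun s _ => (hM i s).mul (hN s j)

theorem hasAllMoments_matrix_pow [IsProbabilityMeasure P] {V : Type*} [Fintype V] [DecidableEq V] {M : Ω₀ → Matrix V V ℝ}
    (hM : ∀ i j, HasAllMoments (fun ω => M ω i j) P) (q : ℕ) (i j : V) :
    HasAllMoments (fun ω => (M ω ^ q) i j) P := by
  induction q generalizing i j with
  | zero => simpa using HasAllMoments.const _
  | succ q ih =>
    simp only [pow_succ]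
    exact hasAllMoments_matrix_mul ih hM i j

theorem hasAllMoments_trace {V : Type*} [Fintype V] {M : Ω₀ → Matrix V V ℝ}
    (hM : ∀ i j, HasAllMoments (fun ω => M ω i j) P) : HasAllMoments (fun ω => trace (M ω)) P := by
  simp only [trace]
  exact HasAllMoments.sum _ fun s _ => hM s s

/-- Exponential square integrability gives all moments. -/
theorem hasAllMoments_of_exp_sq [IsProbabilityMeasure P] {x : Ω₀ → ℝ} (hx : Measurable x) {θ : ℝ} (hθ : 0 < θ)
    (h : Integrable (fun ω => Real.exp (θ * x ω ^ 2)) P) : HasAllMoments x P := by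
  intro p
  have h2 : MemLp x ((2 * p : ℕ) : ℝ≥0∞) P := by
    rcases Nat.eq_zero_or_pos p with rfl | hp
    · simpa using hx.aestronglyMeasurable
    rw [← integrable_norm_rpow_iff hx.aestronglyMeasurable (by simp; omega)
      (ENNReal.natCast_ne_top _)]
    have e : ∀ ω, ‖x ω‖ ^ (((2 * p : ℕ) : ℝ≥0∞).toReal) = (x ω ^ 2) ^ p := by
      intro ω
      rw [ENNReal.toReal_natCast, Real.rpow_natCast, pow_mul, Real.norm_eq_abs, sq_abs]
    simp only [e]
    refine Integrable.mono' (h.const_mul ((p.factorial : ℝ) / θ ^ p))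
      ((hx.pow_const 2).pow_const p).aestronglyMeasurable (Filter.Eventually.of_forall fun ω => ?_)
    rw [Real.norm_of_nonneg (by positivity)]
    have := Real.pow_div_factorial_le_exp (θ * x ω ^ 2) (by positivity) p
    rw [mul_pow, div_le_iff₀ (by positivity)] at this
    rw [div_mul_eq_mul_div, le_div_iff₀ (by positivity)]
    linarith
  exact h2.mono_exponent (by exact_mod_cast (by omega : p ≤ 2 * p))

end Moments

section Core

variable {V : Type*} [Fintype V] [DecidableEq V]

/-- Symmetrization bound for a matrix polynomial in a single centred random variable. -/
theorem integral_mul_trace_pow_le {Ω₀ : Type*} [MeasurableSpace Ω₀] {ν : Measure Ω₀}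
    [IsProbabilityMeasure ν] {x : Ω₀ → ℝ} (hx : HasAllMoments x ν) (hx0 : ∫ y, x y ∂ν = 0)
    {A S : Matrix V V ℝ} (hA : Aᵀ = A) (hS : S.IsHermitian) {m : ℕ} (hm : Even m) :
    ∫ y, x y * trace (A * (S + x y • A) ^ (m + 1)) ∂ν ≤
      (m + 1) / 2 * ∫ y, (x y ^ 2 + ∫ y', x y' ^ 2 ∂ν) * trace (A * A * (S + x y • A) ^ m) ∂ν := by
  have hent : ∀ i j, HasAllMoments (fun y => (S + x y • A) i j) ν := fun i j => by
    simp only [Matrix.add_apply, Matrix.smul_apply, smul_eq_mul]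
    exact (HasAllMoments.const _).add (hx.mul (HasAllMoments.const _))
  have hF : HasAllMoments (fun y => trace (A * (S + x y • A) ^ (m + 1))) ν :=
    hasAllMoments_trace (hasAllMoments_matrix_mul (fun _ _ => HasAllMoments.const _)
      (hasAllMoments_matrix_pow hent _))
  have hG : HasAllMoments (fun y => trace (A * A * (S + x y • A) ^ m)) ν :=
    hasAllMoments_trace (hasAllMoments_matrix_mul (fun _ _ => HasAllMoments.const _)
      (hasAllMoments_matrix_pow hent _))
  set F := fun y => trace (A * (S + x y • A) ^ (m + 1)) with hFd
  set G := fun y => trace (A * A * (S + x y • A) ^ m) with hGd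
  set v := ∫ y', x y' ^ 2 ∂ν with hv
  have hher : ∀ y, (S + x y • A).IsHermitian := fun y => by
    refine hS.add ?_
    rw [Matrix.IsHermitian, conjTranspose_eq_transpose_of_trivial, transpose_smul, hA]
  have hpt : ∀ y y', (x y - x y') * (F y - F y') ≤
      (x y - x y') ^ 2 * ((m + 1) / 2 * (G y + G y')) := fun y y' =>
    mul_trace_pow_sub_le hA (hher y) (hher y') hm (by rw [add_sub_add_left_eq_sub, sub_smul])
  -- expand both sides into products of functions of separate variables
  have h1 : ∀ y, x y * F y - F y * 0 - (0 * F y) + ∫ y', x y' * F y' ∂ν ≤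
      (m + 1) / 2 * ((x y ^ 2 * G y + v * G y) + (x y ^ 2 * ∫ y', G y' ∂ν)
        - 2 * (x y * ∫ y', x y' * G y' ∂ν) + ∫ y', x y' ^ 2 * G y' ∂ν)
        + x y * ∫ y', F y' ∂ν := by
    intro y
    have i1 := (HasAllMoments.integrable hx)
    have i2 := hF.integrable
    have i3 := (hx.mul hF).integrable
    have i4 := hG.integrable
    have i5 := (hx.mul hG).integrable
    have i6 := ((hx.pow 2).mul hG).integrable
    have i7 := (hx.pow 2).integrable
    have e1 : ∫ y', (x y - x y') * (F y - F y') ∂ν =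
        x y * F y - x y * ∫ y', F y' ∂ν + ∫ y', x y' * F y' ∂ν := by
      have : ∀ y', (x y - x y') * (F y - F y') =
        x y * F y - x y * F y' - F y * x y' + x y' * F y' := fun y' => by ring
      simp only [this]
      rw [integral_add (by fun_prop) i3, integral_sub (by fun_prop) (by fun_prop),
        integral_sub (by fun_prop) (by fun_prop)]
      simp only [integral_const_mul, integral_const, probReal_univ, smul_eq_mul, hx0]
      ring
    have e2 : ∫ y', (x y - x y') ^ 2 * ((m + 1) / 2 * (G y + G y')) ∂ν =
        (m + 1) / 2 * ((x y ^ 2 * G y + v * G y) + (x y ^ 2 * ∫ y', G y' ∂ν)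
        - 2 * (x y * ∫ y', x y' * G y' ∂ν) + ∫ y', x y' ^ 2 * G y' ∂ν) := by
      have : ∀ y', (x y - x y') ^ 2 * ((m + 1) / 2 * (G y + G y')) =
        (m + 1) / 2 * (x y ^ 2 * G y + G y * x y' ^ 2 + x y ^ 2 * G y' - (2 * x y) * (x y' * G y')
          + x y' ^ 2 * G y' - (2 * x y * G y) * x y') := fun y' => by ring
      simp only [this]
      rw [integral_const_mul, integral_sub (by fun_prop) (by fun_prop),
        integral_add (by fun_prop) (by fun_prop), integral_sub (by fun_prop) (by fun_prop),
        integral_add (by fun_prop) (by fun_prop), integral_add (by fun_prop) (by fun_prop)]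
      simp only [integral_const_mul, integral_const, probReal_univ, smul_eq_mul, hx0]
      rw [← hv]
      ring
    have h3 : ∫ y', (x y - x y') * (F y - F y') ∂ν ≤
        ∫ y', (x y - x y') ^ 2 * ((m + 1) / 2 * (G y + G y')) ∂ν := by
      refine integral_mono ?_ ?_ fun y' => hpt y y'
      · have : HasAllMoments (fun y' => (x y - x y') * (F y - F y')) ν :=
          ((HasAllMoments.const _).sub hx).mul ((HasAllMoments.const _).sub hF)
        exact this.integrable
      · have : HasAllMoments (fun y' => (x y - x y') ^ 2 * ((m + 1) / 2 * (G y + G y'))) ν :=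
          (((HasAllMoments.const _).sub hx).pow 2).mul
            ((HasAllMoments.const _).mul ((HasAllMoments.const _).add hG))
        exact this.integrable
    rw [e1, e2] at h3
    linarith
  have i1 := (HasAllMoments.integrable hx)
  have i3 := (hx.mul hF).integrable
  have i4 := hG.integrable
  have i6 := ((hx.pow 2).mul hG).integrable
  have i7 := (hx.pow 2).integrable
  have h2 : ∫ y, (x y * F y + ∫ y', x y' * F y' ∂ν) ∂ν ≤
      ∫ y, ((m + 1) / 2 * ((x y ^ 2 * G y + v * G y) + (x y ^ 2 * ∫ y', G y' ∂ν)
        - 2 * (x y * ∫ y', x y' * G y' ∂ν) + ∫ y', x y' ^ 2 * G y' ∂ν)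
        + x y * ∫ y', F y' ∂ν) ∂ν := by
    refine integral_mono (by fun_prop) (by fun_prop) fun y => ?_
    have := h1 y
    simpa using this
  rw [integral_add i3 (by fun_prop), integral_add (by fun_prop) (by fun_prop), integral_const_mul,
    integral_add (by fun_prop) (by fun_prop), integral_sub (by fun_prop) (by fun_prop),
    integral_add (by fun_prop) (by fun_prop), integral_add (by fun_prop) (by fun_prop),
    ] at h2
  simp only [integral_const_mul, integral_mul_const, integral_const, probReal_univ, smul_eq_mul,
    hx0] at h2
  rw [← hv] at h2
  have e3 : ∫ y, (x y ^ 2 + v) * G y ∂ν = ∫ y, x y ^ 2 * G y ∂ν + v * ∫ y, G y ∂ν := by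
    simp only [add_mul]
    rw [integral_add i6 (by fun_prop), integral_const_mul]
  rw [e3]
  linarith

end Core

section Product

variable {E Ω₀ : Type*} [Fintype E] [DecidableEq E] [MeasurableSpace Ω₀] {μ : E → Measure Ω₀}
  [∀ e, IsProbabilityMeasure (μ e)]

theorem measurePreserving_update (e : E) :
    MeasurePreserving (fun p : (E → Ω₀) × Ω₀ => Function.update p.1 e p.2)
      ((Measure.pi μ).prod (μ e)) (Measure.pi μ) := by
  have hm : Measurable (fun p : (E → Ω₀) × Ω₀ => Function.update p.1 e p.2) := by
    refine measurable_pi_iff.mpr fun a => ?_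
    by_cases h : a = e
    · subst h; simpa using measurable_snd
    · simp only [Function.update_of_ne h]
      exact (measurable_pi_apply a).comp measurable_fst
  refine ⟨hm, (Measure.pi_eq fun s hs => ?_).symm⟩
  rw [Measure.map_apply hm (MeasurableSet.univ_pi hs)]
  have : (fun p : (E → Ω₀) × Ω₀ => Function.update p.1 e p.2) ⁻¹' Set.univ.pi s
      = (Set.univ.pi (Function.update s e Set.univ)) ×ˢ (s e) := by
    ext ⟨f, y⟩
    simp only [Set.mem_preimage, Set.mem_pi, Set.mem_univ, true_imp_iff, Set.mem_prod]
    constructor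
    · intro h
      refine ⟨fun i => ?_, by simpa using h e⟩
      by_cases hi : i = e
      · subst hi; simp
      · simpa [hi] using h i
    · rintro ⟨h1, h2⟩ i
      by_cases hi : i = e
      · subst hi; simpa using h2
      · simpa [hi] using h1 i
  rw [this, Measure.prod_prod, Measure.pi_pi, ← Finset.mul_prod_erase _ _ (Finset.mem_univ e),
    ← Finset.mul_prod_erase _ (fun i => μ i (s i)) (Finset.mem_univ e), Function.update_self,
    measure_univ, one_mul, mul_comm]
  congr 1
  refine Finset.prod_congr rfl fun i hi => ?_
  rw [Function.update_of_ne (Finset.ne_of_mem_erase hi)]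

theorem integral_le_of_forall_integral_update_le (e : E) {f g : (E → Ω₀) → ℝ}
    (hf : Integrable f (Measure.pi μ)) (hg : Integrable g (Measure.pi μ))
    (h : ∀ ω, ∫ y, f (Function.update ω e y) ∂(μ e) ≤ ∫ y, g (Function.update ω e y) ∂(μ e)) :
    ∫ ω, f ω ∂(Measure.pi μ) ≤ ∫ ω, g ω ∂(Measure.pi μ) := by
  have hmp := measurePreserving_update (μ := μ) e
  have key : ∀ {f : (E → Ω₀) → ℝ}, Integrable f (Measure.pi μ) →
      Integrable (fun ω => ∫ y, f (Function.update ω e y) ∂(μ e)) (Measure.pi μ) ∧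
      ∫ ω, f ω ∂(Measure.pi μ) = ∫ ω, ∫ y, f (Function.update ω e y) ∂(μ e) ∂(Measure.pi μ) := by
    intro f hf
    have h1 : Integrable (fun p : (E → Ω₀) × Ω₀ => f (Function.update p.1 e p.2))
        ((Measure.pi μ).prod (μ e)) := hmp.integrable_comp_of_integrable hf
    refine ⟨h1.integral_prod_left, ?_⟩
    rw [← integral_prod _ h1]
    conv_lhs => rw [← hmp.map_eq]
    rw [integral_map hmp.measurable.aemeasurable]
    rw [hmp.map_eq]
    exact hf.aestronglyMeasurable
  rw [(key hf).2, (key hg).2]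
  exact integral_mono (key hf).1 (key hg).1 h

variable {V : Type*} [Fintype V] [DecidableEq V]

theorem isHermitian_sum_smul {A : E → Matrix V V ℝ} (hA : ∀ e, (A e)ᵀ = A e) (c : E → ℝ) :
    (∑ e, c e • A e).IsHermitian := by
  rw [Matrix.IsHermitian, conjTranspose_eq_transpose_of_trivial, transpose_sum]
  simp [hA]

theorem hasAllMoments_sum_smul {x : E → Ω₀ → ℝ} (hx : ∀ e, HasAllMoments (x e) (μ e))
    (A : E → Matrix V V ℝ) (i j : V) :
    HasAllMoments (fun ω : E → Ω₀ => (∑ e, x e (ω e) • A e) i j) (Measure.pi μ) := by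
  simp only [Matrix.sum_apply, Matrix.smul_apply, smul_eq_mul]
  exact HasAllMoments.sum _ fun e _ =>
    ((hx e).comp (measurePreserving_eval μ e)).mul (HasAllMoments.const _)

theorem integral_trace_pow_le_integral_sum_pow {x : E → Ω₀ → ℝ}
    (hx : ∀ e, HasAllMoments (x e) (μ e)) (hx0 : ∀ e, ∫ y, x e y ∂(μ e) = 0)
    {A : E → Matrix V V ℝ} (hA : ∀ e, (A e)ᵀ = A e) {α : E → V → ℝ} (hα : ∀ e v, 0 ≤ α e v)
    (hAA : ∀ e, A e * A e = diagonal (α e)) (q : ℕ) :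
    ∫ ω, trace ((∑ e, x e (ω e) • A e) ^ (2 * (q + 1))) ∂(Measure.pi μ) ≤
      ∫ ω, ∑ v, ((q + 1) * ∑ e, α e v * (x e (ω e) ^ 2 + ∫ y, x e y ^ 2 ∂(μ e))) ^ (q + 1)
        ∂(Measure.pi μ) := by
  have hX := hasAllMoments_sum_smul hx A
  set X : (E → Ω₀) → Matrix V V ℝ := fun ω => ∑ e, x e (ω e) • A e with hXd
  set s : E → (E → Ω₀) → ℝ := fun e ω => x e (ω e) ^ 2 + ∫ y, x e y ^ 2 ∂(μ e) with hs
  have hxe : ∀ e, HasAllMoments (fun ω : E → Ω₀ => x e (ω e)) (Measure.pi μ) := fun e =>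
    (hx e).comp (measurePreserving_eval μ e)
  have hsm : ∀ e, HasAllMoments (s e) (Measure.pi μ) := fun e =>
    ((hxe e).pow 2).add (HasAllMoments.const _)
  have hs0 : ∀ e ω, 0 ≤ s e ω := fun e ω =>
    add_nonneg (sq_nonneg _) (integral_nonneg fun _ => sq_nonneg _)
  have hf : ∀ e, HasAllMoments (fun ω => x e (ω e) * trace (A e * X ω ^ (2 * q + 1)))
      (Measure.pi μ) := fun e => (hxe e).mul (hasAllMoments_trace
    (hasAllMoments_matrix_mul (fun _ _ => HasAllMoments.const _) (hasAllMoments_matrix_pow hX _)))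
  have hg : ∀ e, HasAllMoments (fun ω => s e ω * trace (A e * A e * X ω ^ (2 * q)))
      (Measure.pi μ) := fun e => (hsm e).mul (hasAllMoments_trace
    (hasAllMoments_matrix_mul (fun _ _ => HasAllMoments.const _) (hasAllMoments_matrix_pow hX _)))
  have hstep : ∀ e, ∫ ω, x e (ω e) * trace (A e * X ω ^ (2 * q + 1)) ∂(Measure.pi μ) ≤
      ∫ ω, ((2 * q : ℕ) + 1) / 2 * (s e ω * trace (A e * A e * X ω ^ (2 * q))) ∂(Measure.pi μ) := by
    intro e
    refine integral_le_of_forall_integral_update_le e (hf e).integrable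
      ((hg e).integrable.const_mul _) fun ω => ?_
    set S := X ω - x e (ω e) • A e with hSd
    have hXu : ∀ y, X (Function.update ω e y) = S + x e y • A e := by
      intro y
      simp only [hSd, hXd]
      rw [← Finset.add_sum_erase _ _ (Finset.mem_univ e),
        ← Finset.add_sum_erase _ (fun e' => x e' (ω e') • A e') (Finset.mem_univ e)]
      rw [Function.update_self]
      have : ∑ e' ∈ Finset.univ.erase e, x e' (Function.update ω e y e') • A e'
          = ∑ e' ∈ Finset.univ.erase e, x e' (ω e') • A e' :=
        Finset.sum_congr rfl fun e' he' => by
          rw [Function.update_of_ne (Finset.ne_of_mem_erase he')]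
      rw [this]
      abel
    have hSh : S.IsHermitian := by
      refine (isHermitian_sum_smul hA _).sub ?_
      rw [Matrix.IsHermitian, conjTranspose_eq_transpose_of_trivial, transpose_smul, hA]
    simp only [hXu, hs, Function.update_self]
    rw [integral_const_mul]
    exact integral_mul_trace_pow_le (hx e) (hx0 e) (hA e) hSh (even_two_mul q)
  have hdiag : ∀ ω, ∑ e, (((2 * q : ℕ) : ℝ) + 1) / 2 * (s e ω * trace (A e * A e * X ω ^ (2 * q)))
      ≤ ∑ v, ((q + 1) * ∑ e, α e v * s e ω) * (X ω ^ (2 * q)) v v := by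
    intro ω
    have hd : ∀ v, 0 ≤ (X ω ^ (2 * q)) v v := by
      intro v
      have : X ω ^ (2 * q) = (X ω ^ q)ᵀ * X ω ^ q := by
        have hh : (X ω)ᵀ = X ω := by
          have := isHermitian_sum_smul hA (fun e => x e (ω e))
          rwa [Matrix.IsHermitian, conjTranspose_eq_transpose_of_trivial] at this
        rw [transpose_pow, hh, ← pow_add, two_mul]
      rw [this, Matrix.mul_apply]
      exact Finset.sum_nonneg fun i _ => by
        rw [transpose_apply]; exact mul_self_nonneg _
    have e1 : ∀ e, trace (A e * A e * X ω ^ (2 * q)) = ∑ v, α e v * (X ω ^ (2 * q)) v v := by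
      intro e
      rw [hAA, trace]
      simp [diagonal_mul]
    calc _ = ∑ v, ((((2 * q : ℕ) : ℝ) + 1) / 2 * ∑ e, α e v * s e ω) * (X ω ^ (2 * q)) v v := by
          simp only [e1, Finset.mul_sum, Finset.sum_mul]
          rw [Finset.sum_comm]
          refine Finset.sum_congr rfl fun v _ => Finset.sum_congr rfl fun e _ => by ring
      _ ≤ _ := by
          refine Finset.sum_le_sum fun v _ => mul_le_mul_of_nonneg_right ?_ (hd v)
          refine mul_le_mul_of_nonneg_right ?_
            (Finset.sum_nonneg fun e _ => mul_nonneg (hα e v) (hs0 e ω))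
          push_cast
          linarith
  have hY : HasAllMoments (fun ω => ∑ v, ((q + 1) * ∑ e, α e v * s e ω) ^ (q + 1)) (Measure.pi μ) :=
    HasAllMoments.sum _ fun v _ => ((HasAllMoments.const _).mul (HasAllMoments.sum _ fun e _ =>
      (HasAllMoments.const _).mul (hsm e))).pow _
  have hT : HasAllMoments (fun ω => trace (X ω ^ (2 * (q + 1)))) (Measure.pi μ) :=
    hasAllMoments_trace (hasAllMoments_matrix_pow hX _)
  have h1 : ∫ ω, trace (X ω ^ (2 * (q + 1))) ∂(Measure.pi μ) ≤
      ∫ ω, ∑ e, (((2 * q : ℕ) : ℝ) + 1) / 2 * (s e ω * trace (A e * A e * X ω ^ (2 * q)))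
        ∂(Measure.pi μ) := by
    have e2 : ∀ ω, trace (X ω ^ (2 * (q + 1))) =
        ∑ e, x e (ω e) * trace (A e * X ω ^ (2 * q + 1)) := by
      intro ω
      rw [show 2 * (q + 1) = (2 * q + 1) + 1 by ring, pow_succ']
      conv_lhs => enter [1, 1]; rw [hXd]
      rw [Finset.sum_mul, trace_sum]
      simp
    simp only [e2]
    rw [integral_finsetSum _ fun e _ => (hf e).integrable,
      integral_finsetSum _ fun e _ => (hg e).integrable.const_mul _]
    exact Finset.sum_le_sum fun e _ => hstep e
  have h2 : ∫ ω, (q + 1) * ∑ e, (((2 * q : ℕ) : ℝ) + 1) / 2 *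
        (s e ω * trace (A e * A e * X ω ^ (2 * q))) ∂(Measure.pi μ) ≤
      ∫ ω, (∑ v, ((q + 1) * ∑ e, α e v * s e ω) ^ (q + 1) + q * trace (X ω ^ (2 * (q + 1))))
        ∂(Measure.pi μ) := by
    refine integral_mono ?_ (hY.integrable.add (hT.integrable.const_mul _)) fun ω => ?_
    · exact (integrable_finsetSum _ fun e _ => (hg e).integrable.const_mul _).const_mul _
    · refine le_trans (mul_le_mul_of_nonneg_left (hdiag ω) (by positivity)) ?_
      exact sum_mul_pow_diag_le (isHermitian_sum_smul hA _) (fun v => mul_nonneg (by positivity)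
        (Finset.sum_nonneg fun e _ => mul_nonneg (hα e v) (hs0 e ω))) q
  rw [integral_const_mul, integral_add hY.integrable (hT.integrable.const_mul _),
    integral_const_mul] at h2
  have hq : (0:ℝ) ≤ q := Nat.cast_nonneg q
  nlinarith [mul_le_mul_of_nonneg_left h1 (by positivity : (0:ℝ) ≤ q + 1)]

end Product

theorem pow_le_mul_exp {y θ : ℝ} (hy : 0 ≤ y) (hθ : 0 < θ) {p : ℕ} (hp : p ≠ 0) :
    y ^ p ≤ (p / (θ * Real.exp 1)) ^ p * Real.exp (θ * y) := by
  have hp0 : (0:ℝ) < p := by exact_mod_cast Nat.pos_of_ne_zero hp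
  have h1 : θ * y / p ≤ Real.exp (θ * y / p - 1) := by
    have := Real.add_one_le_exp (θ * y / p - 1); linarith
  have h2 : y ≤ p / (θ * Real.exp 1) * Real.exp (θ * y / p) := by
    rw [Real.exp_sub, div_le_div_iff₀ hp0 (Real.exp_pos 1)] at h1
    rw [div_mul_eq_mul_div, le_div_iff₀ (by positivity)]
    nlinarith
  calc y ^ p ≤ (p / (θ * Real.exp 1) * Real.exp (θ * y / p)) ^ p := pow_le_pow_left₀ hy h2 p
    _ = _ := by
      rw [mul_pow, ← Real.exp_nat_mul]
      congr 2
      field_simp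

section Tail

variable {E Ω₀ : Type*} [Fintype E] [DecidableEq E] [MeasurableSpace Ω₀] {μ : E → Measure Ω₀}
  [∀ e, IsProbabilityMeasure (μ e)] {V : Type*} [Fintype V] [DecidableEq V]

theorem integral_sum_pow_le {x : E → Ω₀ → ℝ} (hxm : ∀ e, Measurable (x e)) {θ : ℝ} (hθ : 0 < θ)
    (hexp : ∀ e, Integrable (fun y => Real.exp (θ * x e y ^ 2)) (μ e))
    {inc : E → V → Prop} [∀ e v, Decidable (inc e v)] {ρ : E → ℝ}
    (hρ : ∀ e, ∫ y, Real.exp (θ * (x e y ^ 2 + ∫ y, x e y ^ 2 ∂(μ e))) ∂(μ e) ≤ ρ e)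
    {p : ℕ} (hp : p ≠ 0) :
    ∫ ω, ∑ v, (p * ∑ e, (if inc e v then (1:ℝ) else 0) *
        (x e (ω e) ^ 2 + ∫ y, x e y ^ 2 ∂(μ e))) ^ p ∂(Measure.pi μ) ≤
      (p ^ 2 / (θ * Real.exp 1)) ^ p * ∑ v, ∏ e, if inc e v then ρ e else 1 := by
  have hx : ∀ e, HasAllMoments (x e) (μ e) := fun e => hasAllMoments_of_exp_sq (hxm e) hθ (hexp e)
  set w : E → ℝ := fun e => ∫ y, x e y ^ 2 ∂(μ e) with hw
  have hw0 : ∀ e, 0 ≤ w e := fun e => integral_nonneg fun _ => sq_nonneg _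
  have hY : ∀ v, HasAllMoments (fun ω : E → Ω₀ => (p * ∑ e, (if inc e v then (1:ℝ) else 0) *
        (x e (ω e) ^ 2 + w e)) ^ p) (Measure.pi μ) := fun v =>
    ((HasAllMoments.const _).mul (HasAllMoments.sum _ fun e _ => (HasAllMoments.const _).mul
      ((((hx e).comp (measurePreserving_eval μ e)).pow 2).add (HasAllMoments.const _)))).pow _
  rw [integral_finsetSum _ fun v _ => (hY v).integrable, Finset.mul_sum]
  refine Finset.sum_le_sum fun v _ => ?_
  set f : E → Ω₀ → ℝ := fun e y => Real.exp (θ * ((if inc e v then (1:ℝ) else 0) * (x e y ^ 2 + w e)))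
    with hf
  have hfi : ∀ e, Integrable (f e) (μ e) := by
    intro e
    simp only [hf]
    split_ifs with h
    · simp only [one_mul, mul_add, Real.exp_add]
      exact (hexp e).mul_const _
    · simp
  have hprod : ∀ ω : E → Ω₀, Real.exp (θ * ∑ e, (if inc e v then (1:ℝ) else 0) * (x e (ω e) ^ 2 + w e))
      = ∏ e, f e (ω e) := fun ω => by
    rw [Finset.mul_sum, Real.exp_sum]
  have h_int : Integrable (fun ω : E → Ω₀ => ∏ e, f e (ω e)) (Measure.pi μ) :=
    Integrable.fintype_prod hfi
  calc _ ≤ ∫ ω, (p ^ 2 / (θ * Real.exp 1)) ^ p * ∏ e, f e (ω e) ∂(Measure.pi μ) := by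
        refine integral_mono (hY v).integrable (h_int.const_mul _) fun ω => ?_
        change (_ : ℝ) ≤ (p ^ 2 / (θ * Real.exp 1)) ^ p * ∏ e, f e (ω e)
        rw [mul_pow, ← hprod]
        have hS : 0 ≤ ∑ e, (if inc e v then (1:ℝ) else 0) * (x e (ω e) ^ 2 + w e) :=
          Finset.sum_nonneg fun e _ => mul_nonneg (by split_ifs <;> norm_num)
            (add_nonneg (sq_nonneg _) (hw0 e))
        refine (mul_le_mul_of_nonneg_left (pow_le_mul_exp hS hθ hp) (by positivity)).trans_eq ?_
        rw [← mul_assoc, ← mul_pow]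
        congr 2
        ring
    _ ≤ _ := by
        rw [integral_const_mul, integral_fintype_prod_eq_prod]
        refine mul_le_mul_of_nonneg_left (Finset.prod_le_prod (fun e _ =>
          integral_nonneg fun y => (Real.exp_pos _).le) fun e _ => ?_) (by positivity)
        simp only [hf]
        split_ifs with h
        · simpa using hρ e
        · simp

variable {m l : Type*} [Fintype m] [DecidableEq m] [Fintype l] [DecidableEq l]

/-- Tail bound for the operator norm of a sparse random matrix with independent entries. -/
theorem measureReal_not_opNorm_le {x : E → Ω₀ → ℝ} (hxm : ∀ e, Measurable (x e)) {θ : ℝ}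
    (hθ : 0 < θ) (hexp : ∀ e, Integrable (fun y => Real.exp (θ * x e y ^ 2)) (μ e))
    (hx0 : ∀ e, ∫ y, x e y ∂(μ e) = 0) {ρ : E → ℝ}
    (hρ : ∀ e, ∫ y, Real.exp (θ * (x e y ^ 2 + ∫ y, x e y ^ 2 ∂(μ e))) ∂(μ e) ≤ ρ e)
    (a : E → m) (b : E → l) {t : ℝ} (ht : 0 < t) {p : ℕ} (hp : p ≠ 0) :
    (Measure.pi μ).real {ω | ¬ specNorm (∑ e, x e (ω e) • Matrix.single (a e) (b e) (1:ℝ)) ≤ t} ≤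
      (p ^ 2 / (θ * Real.exp 1 * t ^ 2)) ^ p *
        (∑ i, (∏ e, if a e = i then ρ e else 1) + ∑ j, ∏ e, if b e = j then ρ e else 1) := by
  obtain ⟨q, rfl⟩ := Nat.exists_eq_succ_of_ne_zero hp
  have hx : ∀ e, HasAllMoments (x e) (μ e) := fun e => hasAllMoments_of_exp_sq (hxm e) hθ (hexp e)
  let A : E → Matrix (m ⊕ l) (m ⊕ l) ℝ := fun e =>
    Matrix.single (Sum.inl (a e)) (Sum.inr (b e)) 1 + Matrix.single (Sum.inr (b e)) (Sum.inl (a e)) 1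
  let inc : E → m ⊕ l → Prop := fun e v => v = Sum.inl (a e) ∨ v = Sum.inr (b e)
  have hA : ∀ e, (A e)ᵀ = A e := fun e => by simp [A, add_comm]
  have hAA : ∀ e, A e * A e = diagonal (fun v => if inc e v then (1:ℝ) else 0) := by
    intro e
    simp only [A, inc, Matrix.add_mul, Matrix.mul_add, Matrix.single_mul_single_same]
    rw [Matrix.single_mul_single_of_ne (h := by simp), Matrix.single_mul_single_of_ne (h := by simp)]
    ext v v'
    rcases v with v | v <;> rcases v' with v' | v' <;>
      simp [Matrix.single_apply, Matrix.diagonal_apply] <;> grind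
  have h1 := integral_trace_pow_le_integral_sum_pow hx hx0 hA
    (α := fun e v => if inc e v then (1:ℝ) else 0) (fun e v => by split_ifs <;> norm_num) hAA q
  have h2 := integral_sum_pow_le (V := m ⊕ l) hxm hθ hexp (inc := inc) hρ (Nat.succ_ne_zero q)
  have h2' : ∫ ω, ∑ v, ((q + 1) * ∑ e, (if inc e v then (1:ℝ) else 0) *
      (x e (ω e) ^ 2 + ∫ y, x e y ^ 2 ∂(μ e))) ^ (q + 1) ∂(Measure.pi μ) ≤
      (((q + 1 : ℕ) : ℝ) ^ 2 / (θ * Real.exp 1)) ^ (q + 1) *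
        ∑ v, ∏ e, if inc e v then ρ e else 1 := by
    simpa using h2
  have h3 := h1.trans h2'
  set X : (E → Ω₀) → Matrix (m ⊕ l) (m ⊕ l) ℝ := fun ω => ∑ e, x e (ω e) • A e with hXd
  have hXh : ∀ ω, (X ω).IsHermitian := fun ω => isHermitian_sum_smul hA _
  have hnn : ∀ ω, 0 ≤ trace (X ω ^ (2 * (q + 1))) := by
    intro ω
    have hh : (X ω)ᵀ = X ω := by
      have := hXh ω
      rwa [Matrix.IsHermitian, conjTranspose_eq_transpose_of_trivial] at this
    have : X ω ^ (2 * (q + 1)) = (X ω ^ (q + 1))ᵀ * X ω ^ (q + 1) := by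
      rw [transpose_pow, hh, ← pow_add, two_mul]
    rw [this, ← sum_sq_eq_trace]
    exact Finset.sum_nonneg fun _ _ => Finset.sum_nonneg fun _ _ => sq_nonneg _
  have hT : HasAllMoments (fun ω => trace (X ω ^ (2 * (q + 1)))) (Measure.pi μ) :=
    hasAllMoments_trace (hasAllMoments_matrix_pow (hasAllMoments_sum_smul hx A) _)
  have hmk := mul_meas_ge_le_integral_of_nonneg (Filter.Eventually.of_forall hnn) hT.integrable
    (t ^ (2 * (q + 1)))
  have hsub : {ω | ¬ specNorm (∑ e, x e (ω e) • Matrix.single (a e) (b e) (1:ℝ)) ≤ t} ⊆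
      {ω | t ^ (2 * (q + 1)) ≤ trace (X ω ^ (2 * (q + 1)))} := by
    intro ω hω
    by_contra hcon
    refine hω ?_
    simp only [Set.mem_ofPred_eq, not_le] at hcon
    have h4 := sum_mulVec_sq_le_of_trace_pow_le (hXh ω) (Nat.succ_ne_zero q) hcon.le
    rw [specNorm_le_iff _ ht.le]
    intro y
    have h5 := h4 (Sum.elim 0 y)
    have e1 : ∀ i, (X ω *ᵥ Sum.elim 0 y) (Sum.inl i) =
        ((∑ e, x e (ω e) • Matrix.single (a e) (b e) (1:ℝ)) *ᵥ y) i := by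
      intro i
      simp only [mulVec, dotProduct, Fintype.sum_sum_type, Sum.elim_inl, Sum.elim_inr, Pi.zero_apply,
        mul_zero, Finset.sum_const_zero, zero_add]
      refine Finset.sum_congr rfl fun j _ => ?_
      congr 1
      simp [hXd, A, Matrix.sum_apply, Matrix.single_apply]
    rw [Fintype.sum_sum_type, Fintype.sum_sum_type] at h5
    simp only [e1, Sum.elim_inl, Sum.elim_inr, Pi.zero_apply] at h5
    have h6 : 0 ≤ ∑ j, (X ω *ᵥ Sum.elim 0 y) (Sum.inr j) ^ 2 :=
      Finset.sum_nonneg fun _ _ => sq_nonneg _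
    simp only [ne_eq, OfNat.ofNat_ne_zero, not_false_eq_true, zero_pow, Finset.sum_const_zero,
      zero_add] at h5
    linarith
  have hle : (Measure.pi μ).real {ω | ¬ specNorm (∑ e, x e (ω e) • Matrix.single (a e) (b e) (1:ℝ)) ≤ t}
      ≤ (Measure.pi μ).real {ω | t ^ (2 * (q + 1)) ≤ trace (X ω ^ (2 * (q + 1)))} :=
    measureReal_mono hsub
  have hsum : ∑ v, ∏ e, (if inc e v then ρ e else 1) =
      (∑ i, (∏ e, if a e = i then ρ e else 1) + ∑ j, ∏ e, if b e = j then ρ e else 1) := by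
    rw [Fintype.sum_sum_type]
    simp [inc, eq_comm]
  rw [← hsum]
  have htp : 0 < t ^ (2 * (q + 1)) := by positivity
  have h7 : (Measure.pi μ).real {ω | t ^ (2 * (q + 1)) ≤ trace (X ω ^ (2 * (q + 1)))} ≤
      ((((q + 1 : ℕ) : ℝ) ^ 2 / (θ * Real.exp 1)) ^ (q + 1) *
        ∑ v, ∏ e, if inc e v then ρ e else 1) / t ^ (2 * (q + 1)) := by
    rw [le_div_iff₀ htp, mul_comm]
    exact hmk.trans h3
  refine hle.trans (h7.trans_eq ?_)
  rw [mul_div_right_comm, pow_mul, ← div_pow, div_div]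

end Tail

/-- The index with its `k`-th coordinate removed. -/
def restOf (k : Fin n) (i : Index d) : RestIdx d k := fun j => i j.1

theorem restOf_embed (k : Fin n) (a : Fin (d k)) (b : RestIdx d k) :
    restOf k (embed k a b) = b := by
  funext j
  simp [restOf, embed, j.2]

theorem matricize_eq_sum_single (k : Fin n) (X : Tensor d) :
    matricize k X = ∑ i, X i • Matrix.single (i k) (restOf k i) (1 : ℝ) := by
  ext a b
  rw [Matrix.sum_apply, ← sum_embed k]
  simp [embed_self, restOf_embed, Matrix.single_apply, matricize, ite_and]

/-- Sum over rows and columns of the mode-`k` matricization of the product of the entries. -/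
noncomputable def lineSum (k : Fin n) (ρ : Tensor d) : ℝ :=
  ∑ a, (∏ i, if i k = a then ρ i else 1) + ∑ b, ∏ i, if restOf k i = b then ρ i else 1

theorem card_restIdx (k : Fin n) :
    (Fintype.card (RestIdx d k) : ℝ) = ∏ j ∈ Finset.univ.erase k, (d j : ℝ) := by
  rw [Fintype.card_pi, Nat.cast_prod]
  simp only [Fintype.card_fin]
  rw [Finset.prod_subtype (Finset.univ.erase k) (p := fun j => j ≠ k) (by simp)]

theorem card_add_card (k : Fin n) :
    (Fintype.card (Fin (d k)) : ℝ) + Fintype.card (RestIdx d k) = Dk d k := by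
  rw [card_restIdx, Fintype.card_fin, Dk]

theorem lineSum_le (k : Fin n) {ρ : Tensor d} {c : ℝ} (hc : 0 ≤ c) (h0 : ∀ i, 0 ≤ ρ i)
    (h : ∀ i, ρ i ≤ Real.exp c) : lineSum k ρ ≤ Dk d k * Real.exp (c * Dk d k) := by
  have key : ∀ (q : Index d → Prop) [DecidablePred q], (∑ i, if q i then (1:ℝ) else 0) ≤ Dk d k →
      (∏ i, if q i then ρ i else 1) ≤ Real.exp (c * Dk d k) := by
    intro q _ hq
    calc (∏ i, if q i then ρ i else 1) ≤ ∏ i, Real.exp (c * if q i then 1 else 0) := by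
          refine Finset.prod_le_prod (fun i _ => ?_) fun i _ => ?_
          · split_ifs
            · exact h0 i
            · exact zero_le_one
          · split_ifs
            · simpa using h i
            · simp
      _ = Real.exp (c * ∑ i, if q i then 1 else 0) := by
          rw [← Real.exp_sum, Finset.mul_sum]
      _ ≤ _ := by gcongr
  have hk := card_add_card (d := d) k
  have hr : ∀ a : Fin (d k), (∏ i : Index d, if i k = a then ρ i else 1) ≤
      Real.exp (c * Dk d k) := by
    intro a
    refine key (fun i => i k = a) ?_
    rw [← sum_embed k]
    simp only [embed_self, Finset.sum_const, Finset.card_univ, nsmul_eq_mul, ← Finset.mul_sum,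
      Finset.sum_ite_eq', Finset.mem_univ, if_true, mul_one]
    rw [← hk]
    have : (0:ℝ) ≤ Fintype.card (Fin (d k)) := by positivity
    linarith
  have hcol : ∀ b : RestIdx d k, (∏ i : Index d, if restOf k i = b then ρ i else 1) ≤
      Real.exp (c * Dk d k) := by
    intro b
    refine key (fun i => restOf k i = b) ?_
    rw [← sum_embed k]
    simp only [restOf_embed, Finset.sum_const, Finset.card_univ, nsmul_eq_mul,
      Finset.sum_ite_eq', Finset.mem_univ, if_true, mul_one]
    rw [← hk]
    have : (0:ℝ) ≤ Fintype.card (RestIdx d k) := by positivity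
    linarith
  calc lineSum k ρ ≤ ∑ _a : Fin (d k), Real.exp (c * Dk d k) +
        ∑ _b : RestIdx d k, Real.exp (c * Dk d k) :=
        add_le_add (Finset.sum_le_sum fun a _ => hr a) (Finset.sum_le_sum fun b _ => hcol b)
    _ = _ := by
        rw [Finset.sum_const, Finset.sum_const, nsmul_eq_mul, nsmul_eq_mul, ← add_mul,
          Finset.card_univ, Finset.card_univ, hk]

theorem lineSum_nonneg (k : Fin n) {ρ : Tensor d} (h0 : ∀ i, 0 ≤ ρ i) : 0 ≤ lineSum k ρ := by
  have : ∀ (q : Index d → Prop) [DecidablePred q] (i : Index d), 0 ≤ if q i then ρ i else 1 := by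
    intro q _ i
    split_ifs
    · exact h0 i
    · exact zero_le_one
  exact add_nonneg (Finset.sum_nonneg fun a _ => Finset.prod_nonneg fun i _ => this (fun i => i k = a) i)
    (Finset.sum_nonneg fun b _ => Finset.prod_nonneg fun i _ => this (fun i => restOf k i = b) i)

/-- The expectation of the line sum of independent entries. -/
theorem integral_lineSum {Ω₀ : Type*} [MeasurableSpace Ω₀] {μ : Index d → Measure Ω₀}
    [∀ i, IsProbabilityMeasure (μ i)] (k : Fin n) {f : Index d → Ω₀ → ℝ}
    (hf : ∀ i, Integrable (f i) (μ i)) :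
    ∫ ω, lineSum k (fun i => f i (ω i)) ∂(Measure.pi μ) =
      lineSum k (fun i => ∫ y, f i y ∂(μ i)) := by
  have hg : ∀ (q : Index d → Prop) [DecidablePred q] (i : Index d),
      Integrable (fun y => if q i then f i y else 1) (μ i) := by
    intro q _ i
    split_ifs
    · exact hf i
    · exact integrable_const _
  have hi : ∀ (q : Index d → Prop) [DecidablePred q],
      Integrable (fun ω : Index d → Ω₀ => ∏ i, if q i then f i (ω i) else 1) (Measure.pi μ) :=
    fun q _ => Integrable.fintype_prod (hg q)
  have hp : ∀ (q : Index d → Prop) [DecidablePred q],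
      ∫ ω : Index d → Ω₀, (∏ i, if q i then f i (ω i) else 1) ∂(Measure.pi μ) =
        ∏ i, if q i then ∫ y, f i y ∂(μ i) else 1 := by
    intro q _
    rw [integral_fintype_prod_eq_prod (fun i y => if q i then f i y else 1)]
    refine Finset.prod_congr rfl fun i _ => ?_
    split_ifs <;> simp
  simp only [lineSum]
  rw [integral_add (integrable_finsetSum _ fun a _ => hi (fun i => i k = a))
    (integrable_finsetSum _ fun b _ => hi (fun i => restOf k i = b)),
    integral_finsetSum _ fun a _ => hi (fun i => i k = a),
    integral_finsetSum _ fun b _ => hi (fun i => restOf k i = b)]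
  simp only [hp]

theorem measureReal_not_specNorm_matricize_le {Ω₀ : Type*} [MeasurableSpace Ω₀]
    {μ : Index d → Measure Ω₀} [∀ i, IsProbabilityMeasure (μ i)] (k : Fin n)
    {x : Index d → Ω₀ → ℝ} (hxm : ∀ e, Measurable (x e)) {θ : ℝ} (hθ : 0 < θ)
    (hexp : ∀ e, Integrable (fun y => Real.exp (θ * x e y ^ 2)) (μ e))
    (hx0 : ∀ e, ∫ y, x e y ∂(μ e) = 0) {ρ : Tensor d}
    (hρ : ∀ e, ∫ y, Real.exp (θ * (x e y ^ 2 + ∫ y, x e y ^ 2 ∂(μ e))) ∂(μ e) ≤ ρ e)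
    {t : ℝ} (ht : 0 < t) {p : ℕ} (hp : p ≠ 0) :
    (Measure.pi μ).real {ω | ¬ specNorm (matricize k fun i => x i (ω i)) ≤ t} ≤
      (p ^ 2 / (θ * Real.exp 1 * t ^ 2)) ^ p * lineSum k ρ := by
  have := measureReal_not_opNorm_le hxm hθ hexp hx0 hρ (fun i => i k) (restOf k) ht hp
  simp only [matricize_eq_sum_single]
  exact this

theorem exists_pow_le_exp {a s : ℝ} (ha : 1 ≤ a) (hs : (Real.exp 1 * a) ^ 2 ≤ s) :
    ∃ p : ℕ, p ≠ 0 ∧ ((p:ℝ) ^ 2 / s) ^ p ≤ Real.exp (1 / (2 * a) - 2 * a) := by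
  have ha0 : 0 < a := by linarith
  have hs0 : 0 < s := lt_of_lt_of_le (by positivity) hs
  refine ⟨⌊a + 1 / 2⌋₊, (Nat.floor_pos.2 (by linarith)).ne', ?_⟩
  set p := ⌊a + 1 / 2⌋₊
  have h1 : (p:ℝ) ≤ a + 1 / 2 := Nat.floor_le (by linarith)
  have h2 : a + 1 / 2 < p + 1 := Nat.lt_floor_add_one _
  have he := Real.exp_pos 1
  have h3 : (p:ℝ) / (Real.exp 1 * a) ≤ Real.exp (p / a - 2) := by
    have h4 : (p:ℝ) / a ≤ Real.exp (p / a - 1) := by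
      have := Real.add_one_le_exp ((p:ℝ) / a - 1)
      linarith
    have h5 : Real.exp ((p:ℝ) / a - 2) = Real.exp (p / a - 1) / Real.exp 1 := by
      rw [← Real.exp_sub]
      congr 1
      ring
    rw [h5, mul_comm, ← div_div]
    gcongr
  calc ((p:ℝ) ^ 2 / s) ^ p ≤ ((p:ℝ) ^ 2 / (Real.exp 1 * a) ^ 2) ^ p := by gcongr
    _ = ((p / (Real.exp 1 * a)) ^ 2) ^ p := by rw [div_pow (p:ℝ)]
    _ ≤ (Real.exp (p / a - 2) ^ 2) ^ p := by gcongr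
    _ = Real.exp (p * (2 * (p / a - 2))) := by
        rw [Real.exp_nat_mul, ← Real.exp_nat_mul (p / a - 2) 2]
        norm_num
    _ ≤ _ := by
        refine Real.exp_le_exp.2 ?_
        have h6 : (p:ℝ) * (2 * (p / a - 2)) = 2 / a * ((p - a) ^ 2 - a ^ 2) := by
          field_simp
          ring
        have h7 : 1 / (2 * a) - 2 * a = 2 / a * (1 / 4 - a ^ 2) := by
          field_simp
          ring
        rw [h6, h7]
        have : ((p:ℝ) - a) ^ 2 ≤ 1 / 4 := by nlinarith
        gcongr

theorem exp_le_one_add_mul {x : ℝ} (h0 : 0 ≤ x) (h1 : x ≤ 77 / 100) :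
    Real.exp x ≤ 1 + 151 / 100 * x := by
  have h := Real.exp_bound' h0 (h1.trans (by norm_num)) (n := 5) (by norm_num)
  simp only [Finset.sum_range_succ, Finset.sum_range_zero, Nat.factorial] at h
  norm_num at h
  have h2 : x ^ 2 ≤ x * (77 / 100) := by nlinarith
  have h3 : x ^ 3 ≤ x * (77 / 100) ^ 2 := by nlinarith
  have h4 : x ^ 4 ≤ x * (77 / 100) ^ 3 := by nlinarith
  have h5 : x ^ 5 ≤ x * (77 / 100) ^ 4 := by nlinarith
  linarith

theorem exp_mul_inv_sqrt_le {x : ℝ} (h0 : 0 ≤ x) (h1 : x ≤ 34 / 100) :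
    Real.exp x * (√(1 - 2 * x))⁻¹ ≤ 1 + 44 / 10 * x := by
  have hs : 0 < √(1 - 2 * x) := Real.sqrt_pos.2 (by linarith)
  rw [← div_eq_mul_inv, div_le_iff₀ hs]
  refine abs_le_of_sq_le_sq' ?_ (by positivity) |>.2
  rw [mul_pow, Real.sq_sqrt (by linarith), ← Real.exp_nat_mul]
  have h := Real.exp_bound' (x := (2:ℕ) * x) (by positivity) (by push_cast; linarith) (n := 4)
    (by norm_num)
  refine h.trans ?_
  simp only [Finset.sum_range_succ, Finset.sum_range_zero, Nat.factorial]
  norm_num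
  have h2 : x ^ 2 ≤ x * (34 / 100) := by nlinarith
  have h3 : x ^ 3 ≤ x * (34 / 100) ^ 2 := by nlinarith
  have h4 : x ^ 4 ≤ x * (34 / 100) ^ 3 := by nlinarith
  nlinarith

theorem exp_four_le : Real.exp 4 ≤ 55 := by
  have h := Real.exp_one_lt_d9.le
  have e : Real.exp 4 = Real.exp 1 ^ 4 := by rw [← Real.exp_nat_mul]; norm_num
  rw [e]
  calc Real.exp 1 ^ 4 ≤ 2.7182818286 ^ 4 := pow_le_pow_left₀ (Real.exp_pos 1).le h 4
    _ ≤ 55 := by norm_num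

theorem exp_seven_halves_le : Real.exp (7 / 2) ≤ 33.6 := by
  have h := Real.exp_one_lt_d9.le
  have e : Real.exp (7 / 2) ^ 2 = Real.exp 1 ^ 7 := by
    rw [← Real.exp_nat_mul, ← Real.exp_nat_mul]; norm_num
  refine abs_le_of_sq_le_sq' ?_ (by norm_num) |>.2
  rw [e]
  calc Real.exp 1 ^ 7 ≤ 2.7182818286 ^ 7 := pow_le_pow_left₀ (Real.exp_pos 1).le h 7
    _ ≤ _ := by norm_num

theorem le_log_of_le {D : ℝ} (hD : 48 ≤ D) : 38 / 10 ≤ Real.log D := by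
  rw [Real.le_log_iff_exp_le (by linarith)]
  refine le_trans ?_ hD
  have h := Real.exp_one_lt_d9.le
  have e : Real.exp (38 / 10) ^ 5 = Real.exp 1 ^ 19 := by
    rw [← Real.exp_nat_mul, ← Real.exp_nat_mul]; norm_num
  rw [← pow_le_pow_iff_left₀ (Real.exp_pos _).le (by norm_num) (n := 5) (by norm_num), e]
  calc Real.exp 1 ^ 19 ≤ 2.7182818286 ^ 19 := pow_le_pow_left₀ (Real.exp_pos 1).le h 19
    _ ≤ _ := by norm_num

section Bernoulli

theorem isProbabilityMeasure_bern {p : ℝ} (h0 : 0 ≤ p) (h1 : p ≤ 1) :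
    IsProbabilityMeasure (bern p) := by
  constructor
  simp only [bern, Measure.add_apply, Measure.smul_apply, measure_univ, smul_eq_mul, mul_one]
  rw [← ENNReal.ofReal_add h0 (by linarith)]
  simp

theorem integral_bern {p : ℝ} (h0 : 0 ≤ p) (h1 : p ≤ 1) (f : Bool → ℝ) :
    ∫ b, f b ∂(bern p) = p * f true + (1 - p) * f false := by
  rw [bern, integral_add_measure (.smul_measure (integrable_dirac (by simp)) (by simp))
    (.smul_measure (integrable_dirac (by simp)) (by simp)), integral_smul_measure,
    integral_smul_measure, integral_dirac, integral_dirac, ENNReal.toReal_ofReal h0,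
    ENNReal.toReal_ofReal (by linarith), smul_eq_mul, smul_eq_mul]

theorem integrable_bool {μ : Measure Bool} [IsFiniteMeasure μ] (f : Bool → ℝ) : Integrable f μ :=
  .of_finite

end Bernoulli

section Gaussian

theorem integral_exp_mul_sq_gaussianReal {v : NNReal} (hv : v ≠ 0) {s : ℝ} (hs : s < 1 / 2) :
    ∫ z, Real.exp (s / v * z ^ 2) ∂(gaussianReal 0 v) = (√(1 - 2 * s))⁻¹ := by
  have hv0 : (0:ℝ) < v := by positivity
  rw [integral_gaussianReal_eq_integral_smul hv]
  have e : ∀ x : ℝ, gaussianPDFReal 0 v x • Real.exp (s / v * x ^ 2) =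
      (√(2 * Real.pi * v))⁻¹ * Real.exp (-((1 - 2 * s) / (2 * v)) * x ^ 2) := by
    intro x
    rw [gaussianPDFReal, smul_eq_mul, mul_assoc, ← Real.exp_add]
    congr 2
    field_simp
    ring
  simp only [e]
  rw [integral_const_mul, integral_gaussian, ← Real.sqrt_inv, ← Real.sqrt_inv,
    ← Real.sqrt_mul (by positivity)]
  congr 1
  have : 1 - 2 * s ≠ 0 := by linarith
  field_simp

theorem integrable_exp_mul_sq_gaussianReal {v : NNReal} (hv : v ≠ 0) {s : ℝ} (hs : s < 1 / 2) :
    Integrable (fun z => Real.exp (s / v * z ^ 2)) (gaussianReal 0 v) := by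
  by_contra h
  have h1 := integral_exp_mul_sq_gaussianReal hv hs
  rw [integral_undef h] at h1
  have : 0 < (√(1 - 2 * s))⁻¹ := inv_pos.2 (Real.sqrt_pos.2 (by linarith))
  linarith

theorem integral_sq_gaussianReal (v : NNReal) : ∫ z, z ^ 2 ∂(gaussianReal 0 v) = v := by
  have h := variance_eq_sub (memLp_id_gaussianReal (μ := 0) (v := v) 2)
  rw [variance_id_gaussianReal] at h
  simpa using h.symm

end Gaussian

theorem exp_neg_mul_log_mul_le {D c : ℝ} (hD : 0 < D) :
    Real.exp (c - 3 * Real.log D) = Real.exp c / D ^ 3 := by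
  rw [Real.exp_sub, mul_comm, Real.exp_mul, Real.exp_log hD]
  norm_cast

theorem measureReal_sampling_deviation_le {W : Tensor d} (hW0 : ∀ i, 0 < W i)
    (hW1 : ∀ i, W i ≤ 1) (k : Fin n) (hD : 48 ≤ Dk d k) (hWD : ∀ i, 1 / W i ≤ Dk d k / 2) :
    (sampleMeasure W).real {ω | ¬ specNorm (matricize k
        fun i => (bindic ω i - W i) / √(W i)) ≤ 2 * √(Dk d k) * Real.log (Dk d k)} ≤
      13 / 10 / Dk d k := by
  have : ∀ i, IsProbabilityMeasure (bern (W i)) := fun i =>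
    isProbabilityMeasure_bern (hW0 i).le (hW1 i)
  set D := Dk d k
  have hD0 : 0 < D := by linarith
  have hl := le_log_of_le hD
  set l := Real.log D with hldef
  set θ : ℝ := 154 / 100 / D with hθdef
  have hθ : 0 < θ := by positivity
  have he := Real.exp_one_lt_d9.le
  have he0 := Real.exp_pos 1
  set x : Index d → Bool → ℝ := fun i b => ((if b then 1 else 0) - W i) / √(W i) with hx
  have hxt : ∀ i, x i true ^ 2 = (1 - W i) ^ 2 / W i := by
    intro i
    simp [hx, div_pow, Real.sq_sqrt (hW0 i).le]
  have hxf : ∀ i, x i false ^ 2 = W i := by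
    intro i
    have := (hW0 i).ne'
    simp only [hx, Bool.false_eq_true, if_false, div_pow, Real.sq_sqrt (hW0 i).le]
    field_simp
    ring
  have hv : ∀ i, ∫ y, x i y ^ 2 ∂(bern (W i)) = 1 - W i := by
    intro i
    have := (hW0 i).ne'
    rw [integral_bern (hW0 i).le (hW1 i), hxt, hxf]
    field_simp
    ring
  have hρ : ∀ i, ∫ y, Real.exp (θ * (x i y ^ 2 + ∫ y, x i y ^ 2 ∂(bern (W i)))) ∂(bern (W i)) ≤
      Real.exp (251 / 100 * θ) := by
    intro i
    have hw := hW0 i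
    rw [hv, integral_bern (hW0 i).le (hW1 i), hxt, hxf]
    have e1 : (1 - W i) ^ 2 / W i + (1 - W i) = 1 / W i - 1 := by
      field_simp
      ring
    rw [e1, show W i + (1 - W i) = 1 by ring, mul_one]
    have h1 : Real.exp (θ * (1 / W i - 1)) ≤ Real.exp θ * Real.exp (θ / W i) := by
      rw [← Real.exp_add]
      refine Real.exp_le_exp.2 ?_
      have : θ * (1 / W i - 1) = θ / W i - θ := by ring
      rw [this]
      linarith
    have h2 : θ / W i ≤ 77 / 100 := by
      calc θ / W i = θ * (1 / W i) := by ring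
        _ ≤ θ * (D / 2) := mul_le_mul_of_nonneg_left (hWD i) hθ.le
        _ = 77 / 100 := by rw [hθdef]; field_simp; norm_num
    have h3 := exp_le_one_add_mul (by positivity) h2
    have h4 : W i * (1 + 151 / 100 * (θ / W i)) = W i + 151 / 100 * θ := by
      field_simp
    have h5 : 1 + 151 / 100 * θ ≤ Real.exp (151 / 100 * θ) := by
      have := Real.add_one_le_exp (151 / 100 * θ)
      linarith
    calc W i * Real.exp (θ * (1 / W i - 1)) + (1 - W i) * Real.exp θ
        ≤ W i * (Real.exp θ * (1 + 151 / 100 * (θ / W i))) + (1 - W i) * Real.exp θ := by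
          gcongr
          exact h1.trans (by gcongr)
      _ = Real.exp θ * (W i * (1 + 151 / 100 * (θ / W i)) + (1 - W i)) := by ring
      _ = Real.exp θ * (1 + 151 / 100 * θ) := by rw [h4]; ring
      _ ≤ Real.exp θ * Real.exp (151 / 100 * θ) := by gcongr
      _ = _ := by rw [← Real.exp_add]; congr 1; ring
  have ht : 0 < 2 * √D * l := by positivity
  have hs : (Real.exp 1 * (3 / 2 * l)) ^ 2 ≤ θ * Real.exp 1 * (2 * √D * l) ^ 2 := by
    have : θ * Real.exp 1 * (2 * √D * l) ^ 2 = 616 / 100 * (Real.exp 1 * l ^ 2) := by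
      rw [mul_pow, mul_pow, Real.sq_sqrt hD0.le, hθdef]
      field_simp
      ring
    rw [this]
    have h2 : (Real.exp 1 * (3 / 2 * l)) ^ 2 = 9 / 4 * Real.exp 1 * (Real.exp 1 * l ^ 2) := by ring
    rw [h2]
    gcongr
    linarith
  obtain ⟨p, hp, hpe⟩ := exists_pow_le_exp (a := 3 / 2 * l) (by linarith) hs
  have hx0 : ∀ i, ∫ y, x i y ∂(bern (W i)) = 0 := by
    intro i
    rw [integral_bern (hW0 i).le (hW1 i)]
    simp only [hx, Bool.false_eq_true, if_false, if_true]
    ring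
  have main := measureReal_not_specNorm_matricize_le k (μ := fun i => bern (W i)) (x := x)
    (fun _ => measurable_of_finite _) hθ (fun _ => integrable_bool _) hx0 hρ ht hp
  have hls := lineSum_le k (ρ := fun _ : Index d => Real.exp (251 / 100 * θ)) (by positivity)
    (fun _ => (Real.exp_pos _).le) (fun _ => le_rfl)
  refine main.trans ?_
  calc ((p:ℝ) ^ 2 / (θ * Real.exp 1 * (2 * √D * l) ^ 2)) ^ p *
        lineSum k (fun _ : Index d => Real.exp (251 / 100 * θ))
      ≤ Real.exp (1 / (2 * (3 / 2 * l)) - 2 * (3 / 2 * l)) *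
          (D * Real.exp (251 / 100 * θ * D)) := by
        refine mul_le_mul hpe hls (lineSum_nonneg k fun _ => (Real.exp_pos _).le)
          (Real.exp_pos _).le
    _ = D * Real.exp (1 / (3 * l) + 251 / 100 * θ * D - 3 * l) := by
        rw [mul_left_comm, ← Real.exp_add]
        congr 2
        ring
    _ ≤ D * Real.exp (4 - 3 * l) := by
        have h1 : 251 / 100 * θ * D = 251 * 154 / 10000 := by
          rw [hθdef]
          field_simp
          norm_num
        have h2 : 1 / (3 * l) ≤ 1 / (3 * (38 / 10)) := by gcongr
        have h3 : 1 / (3 * l) + 251 / 100 * θ * D - 3 * l ≤ 4 - 3 * l := by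
          rw [h1]
          norm_num at h2 ⊢
          linarith
        gcongr
    _ = Real.exp 4 / D / D := by
        rw [exp_neg_mul_log_mul_le hD0]
        field_simp
    _ ≤ _ := by
        refine div_le_div_of_nonneg_right ?_ hD0.le
        rw [div_le_iff₀ hD0]
        have := exp_four_le
        linarith

/-- Upper bounds on the exponential moments of the sampled noise entries. -/
noncomputable def noiseWeight (k : Fin n) (W : Tensor d) (i : Index d) (b : Bool) : ℝ :=
  if b then 1 + 44 / 10 * (68 / 100 / Dk d k / W i) else 1

theorem measureReal_noise_le {W : Tensor d} (hW0 : ∀ i, 0 < W i)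
    (k : Fin n) (hD : 48 ≤ Dk d k) (hWD : ∀ i, 1 / W i ≤ Dk d k / 2) {σ : ℝ} (hσ : 0 < σ)
    (ω : Index d → Bool) :
    (gaussianTensor d σ).real {z | ¬ specNorm (matricize k
        fun i => bindic ω i / √(W i) * z i) ≤ 4 * σ * √(Dk d k) * Real.log (Dk d k)} ≤
      Real.exp (1 / (4 * Real.log (Dk d k)) - 4 * Real.log (Dk d k)) *
        lineSum k (fun i => noiseWeight k W i (ω i)) := by
  set D := Dk d k with hDdef
  have hD0 : 0 < D := by linarith
  have hl := le_log_of_le hD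
  set l := Real.log D with hldef
  set v : NNReal := (σ ^ 2).toNNReal with hvdef
  have hvσ : (v:ℝ) = σ ^ 2 := Real.coe_toNNReal _ (by positivity)
  have hv : v ≠ 0 := by
    intro h
    rw [h] at hvσ
    have : 0 < σ ^ 2 := by positivity
    simp at hvσ
    linarith
  set θ : ℝ := 68 / 100 / D / σ ^ 2 with hθdef
  have hθ : 0 < θ := by positivity
  have he := Real.exp_one_lt_d9.le
  have he0 := Real.exp_pos 1
  set s : Index d → ℝ := fun i => if ω i then 68 / 100 / D / W i else 0 with hs
  set x : Index d → ℝ → ℝ := fun i z => bindic ω i / √(W i) * z with hx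
  have hx2 : ∀ i z, θ * x i z ^ 2 = s i / v * z ^ 2 := by
    intro i z
    have h1 := hW0 i
    simp only [hx, hs, bindic, hθdef, hvσ, mul_pow, div_pow, Real.sq_sqrt h1.le]
    split_ifs
    · field_simp
    · simp
  have hs2 : ∀ i, 0 ≤ s i ∧ s i ≤ 34 / 100 := by
    intro i
    have h1 := hW0 i
    simp only [hs]
    split_ifs
    · refine ⟨by positivity, ?_⟩
      calc 68 / 100 / D / W i = 68 / 100 / D * (1 / W i) := by ring
        _ ≤ 68 / 100 / D * (D / 2) := mul_le_mul_of_nonneg_left (hWD i) (by positivity)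
        _ = 34 / 100 := by field_simp; norm_num
    · norm_num
  have hm : ∀ i, θ * ∫ y, x i y ^ 2 ∂(gaussianReal 0 v) = s i := by
    intro i
    rw [← integral_const_mul]
    simp only [hx2]
    rw [integral_const_mul, integral_sq_gaussianReal, div_mul_cancel₀]
    exact_mod_cast hv
  have hexp : ∀ i, Integrable (fun y => Real.exp (θ * x i y ^ 2)) (gaussianReal 0 v) := by
    intro i
    simp only [hx2]
    exact integrable_exp_mul_sq_gaussianReal hv (by linarith [(hs2 i).2])
  have hx0 : ∀ i, ∫ y, x i y ∂(gaussianReal 0 v) = 0 := by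
    intro i
    simp only [hx]
    rw [integral_const_mul, integral_id_gaussianReal, mul_zero]
  have hρ : ∀ i, ∫ y, Real.exp (θ * (x i y ^ 2 + ∫ y, x i y ^ 2 ∂(gaussianReal 0 v)))
      ∂(gaussianReal 0 v) ≤ noiseWeight k W i (ω i) := by
    intro i
    simp only [mul_add, hm, hx2, Real.exp_add]
    rw [integral_mul_const, integral_exp_mul_sq_gaussianReal hv (by linarith [(hs2 i).2]), mul_comm]
    refine (exp_mul_inv_sqrt_le (hs2 i).1 (hs2 i).2).trans_eq ?_
    simp only [hs, noiseWeight, ← hDdef]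
    split_ifs <;> simp
  have ht : 0 < 4 * σ * √D * l := by positivity
  have hst : (Real.exp 1 * (2 * l)) ^ 2 ≤ θ * Real.exp 1 * (4 * σ * √D * l) ^ 2 := by
    have : θ * Real.exp 1 * (4 * σ * √D * l) ^ 2 = 1088 / 100 * (Real.exp 1 * l ^ 2) := by
      rw [mul_pow, mul_pow, mul_pow, Real.sq_sqrt hD0.le, hθdef]
      field_simp
      ring
    rw [this]
    have h2 : (Real.exp 1 * (2 * l)) ^ 2 = 4 * Real.exp 1 * (Real.exp 1 * l ^ 2) := by ring
    rw [h2]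
    gcongr
    linarith
  obtain ⟨p, hp, hpe⟩ := exists_pow_le_exp (a := 2 * l) (by linarith) hst
  refine (measureReal_not_specNorm_matricize_le k (μ := fun _ => gaussianReal 0 v) (x := x)
    (fun i => measurable_const.mul measurable_id) hθ hexp hx0 hρ ht hp).trans ?_
  refine mul_le_mul_of_nonneg_right (hpe.trans_eq ?_) (lineSum_nonneg k fun i => ?_)
  · congr 1
    ring
  · have h1 := hW0 i
    simp only [noiseWeight, ← hDdef]
    split_ifs <;> positivity

theorem measureReal_lineSum_noiseWeight_le {W : Tensor d} (hW0 : ∀ i, 0 < W i)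
    (hW1 : ∀ i, W i ≤ 1) (k : Fin n) (hD : 48 ≤ Dk d k) :
    (sampleMeasure W).real {ω | ¬ Real.exp (1 / (4 * Real.log (Dk d k)) - 4 * Real.log (Dk d k)) *
        lineSum k (fun i => noiseWeight k W i (ω i)) ≤ 1 / Dk d k} ≤ 7 / 10 / Dk d k := by
  have : ∀ i, IsProbabilityMeasure (bern (W i)) := fun i =>
    isProbabilityMeasure_bern (hW0 i).le (hW1 i)
  have : IsProbabilityMeasure (sampleMeasure W) := by
    unfold sampleMeasure
    infer_instance
  set D := Dk d k with hDdef
  have hD0 : 0 < D := by linarith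
  have hl := le_log_of_le hD
  set l := Real.log D with hldef
  set C := Real.exp (1 / (4 * l) - 4 * l) with hC
  have hC0 : 0 < C := Real.exp_pos _
  have hnw : ∀ i b, 0 ≤ noiseWeight k W i b := by
    intro i b
    have h1 := hW0 i
    simp only [noiseWeight, ← hDdef]
    split_ifs <;> positivity
  have h_int : ∫ ω, C * lineSum k (fun i => noiseWeight k W i (ω i)) ∂(sampleMeasure W) ≤
      C * (D * Real.exp (44 / 10 * (68 / 100 / D) * D)) := by
    rw [integral_const_mul, sampleMeasure, integral_lineSum k fun i => integrable_bool _]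
    refine mul_le_mul_of_nonneg_left (lineSum_le k (by positivity)
      (fun i => integral_nonneg (hnw i)) fun i => ?_) hC0.le
    rw [integral_bern (hW0 i).le (hW1 i)]
    simp only [noiseWeight, if_true, Bool.false_eq_true, if_false, ← hDdef]
    have h1 := hW0 i
    have h2 : W i * (1 + 44 / 10 * (68 / 100 / D / W i)) + (1 - W i) * 1 =
        44 / 10 * (68 / 100 / D) + 1 := by
      field_simp
      ring
    rw [h2]
    exact Real.add_one_le_exp _
  have hmk := mul_meas_ge_le_integral_of_nonneg (μ := sampleMeasure W)
    (f := fun ω => C * lineSum k (fun i => noiseWeight k W i (ω i)))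
    (Filter.Eventually.of_forall fun ω => mul_nonneg hC0.le
      (lineSum_nonneg k fun i => hnw i _)) .of_finite (1 / D)
  have hsub : (sampleMeasure W).real
      {ω | ¬ C * lineSum k (fun i => noiseWeight k W i (ω i)) ≤ 1 / D} ≤
      (sampleMeasure W).real
      {ω | 1 / D ≤ C * lineSum k (fun i => noiseWeight k W i (ω i))} :=
    measureReal_mono fun ω hω => (not_le.1 hω).le
  refine hsub.trans ?_
  have h1 := hmk.trans h_int
  rw [div_mul_eq_mul_div, one_mul, div_le_iff₀ hD0, mul_comm] at h1
  refine h1.trans ?_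
  have e4 : C * (D * Real.exp (44 / 10 * (68 / 100 / D) * D)) =
      Real.exp (1 / (4 * l) + 44 / 10 * (68 / 100 / D) * D - l - 3 * l) * D := by
    rw [hC, mul_left_comm, ← Real.exp_add, mul_comm]
    congr 2
    ring
  have e5 : Real.exp (1 / (4 * l) + 44 / 10 * (68 / 100 / D) * D - l - 3 * l) ≤
      Real.exp (7 / 2) / D / D ^ 3 := by
    have h2 : 44 / 10 * (68 / 100 / D) * D = 44 * 68 / 1000 := by
      field_simp
      norm_num
    have h3 : 1 / (4 * l) ≤ 1 / (4 * (38 / 10)) := by gcongr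
    rw [exp_neg_mul_log_mul_le hD0, Real.exp_sub, Real.exp_log hD0, h2]
    gcongr
    norm_num at h3 ⊢
    linarith
  rw [e4]
  calc D * (Real.exp (1 / (4 * l) + 44 / 10 * (68 / 100 / D) * D - l - 3 * l) * D)
      ≤ D * (Real.exp (7 / 2) / D / D ^ 3 * D) := by gcongr
    _ = Real.exp (7 / 2) / D / D := by field_simp
    _ ≤ _ := by
      refine div_le_div_of_nonneg_right ?_ hD0.le
      rw [div_le_iff₀ hD0]
      have := exp_seven_halves_le
      linarith

theorem ofReal_one_sub_le_measure {α : Type*} [MeasurableSpace α] {μ : Measure α}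
    [IsProbabilityMeasure μ] {s t : Set α} (h : tᶜ ⊆ s) {x : ℝ} (hx : μ.real s ≤ x) :
    ENNReal.ofReal (1 - x) ≤ μ t := by
  rw [ENNReal.ofReal_sub _ (measureReal_nonneg.trans hx), ENNReal.ofReal_one,
    tsub_le_iff_right]
  have h1 : μ s ≤ ENNReal.ofReal x := by
    rw [← ofReal_measureReal]
    exact ENNReal.ofReal_le_ofReal hx
  have h2 : (Set.univ : Set α) ⊆ t ∪ s := fun a _ =>
    (em (a ∈ t)).imp id fun ha => h ha
  calc 1 = μ Set.univ := measure_univ.symm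
    _ ≤ μ (t ∪ s) := measure_mono h2
    _ ≤ μ t + μ s := measure_union_le _ _
    _ ≤ _ := by gcongr

theorem Dk_mul_self (k : Fin n) :
    (d k : ℝ) * ∏ j ∈ Finset.univ.erase k, (d j : ℝ) = ∏ j, (d j : ℝ) :=
  Finset.mul_prod_erase Finset.univ (fun j => (d j : ℝ)) (Finset.mem_univ k)

theorem Dk_nonneg (k : Fin n) : 0 ≤ Dk d k := by
  unfold Dk
  positivity

theorem two_mul_sqrt_prod_le_Dk (k : Fin n) : 2 * √(∏ j, (d j : ℝ)) ≤ Dk d k := by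
  refine abs_le_of_sq_le_sq' ?_ (Dk_nonneg k) |>.2
  rw [mul_pow, Real.sq_sqrt (by positivity), ← Dk_mul_self k, Dk]
  nlinarith [sq_nonneg ((d k : ℝ) - ∏ j ∈ Finset.univ.erase k, (d j : ℝ))]

section Card

variable {W : Tensor d}

theorem isProbabilityMeasure_sampleMeasure (hW0 : ∀ i, 0 < W i) (hW1 : ∀ i, W i ≤ 1) :
    IsProbabilityMeasure (sampleMeasure W) := by
  have : ∀ i, IsProbabilityMeasure (bern (W i)) := fun i =>
    isProbabilityMeasure_bern (hW0 i).le (hW1 i)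
  unfold sampleMeasure
  infer_instance

theorem mul_measureReal_le_prod (hW0 : ∀ i, 0 < W i) (hW1 : ∀ i, W i ≤ 1) {f : Bool → ℝ}
    (hf : ∀ b, 0 ≤ f b) (c : ℝ) :
    c * (sampleMeasure W).real {ω | c ≤ ∏ i, f (ω i)} ≤
      ∏ i, (W i * f true + (1 - W i) * f false) := by
  have : ∀ i, IsProbabilityMeasure (bern (W i)) := fun i =>
    isProbabilityMeasure_bern (hW0 i).le (hW1 i)
  have := isProbabilityMeasure_sampleMeasure hW0 hW1
  refine (mul_meas_ge_le_integral_of_nonneg (μ := sampleMeasure W)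
    (Filter.Eventually.of_forall fun ω => Finset.prod_nonneg fun i _ => hf (ω i))
    .of_finite c).trans_eq ?_
  rw [sampleMeasure, integral_fintype_prod_eq_prod (fun _ : Index d => f)]
  exact Finset.prod_congr rfl fun i _ => integral_bern (hW0 i).le (hW1 i) f

theorem prod_one_add_mul_le {c : ℝ} (hW : ∀ i, 0 ≤ 1 + c * W i) :
    ∏ i, (1 + c * W i) ≤ Real.exp (c * ∑ i, W i) := by
  rw [Finset.mul_sum, Real.exp_sum]
  refine Finset.prod_le_prod (fun i _ => hW i) fun i _ => ?_
  have := Real.add_one_le_exp (c * W i)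
  linarith

theorem measureReal_patCard_eq_zero_le (hW0 : ∀ i, 0 < W i) (hW1 : ∀ i, W i ≤ 1) :
    (sampleMeasure W).real {ω | ¬ 0 < patCard ω} ≤ Real.exp (-∑ i, W i) := by
  have := isProbabilityMeasure_sampleMeasure hW0 hW1
  have h := mul_measureReal_le_prod hW0 hW1 (f := fun b => if b then 0 else 1)
    (fun b => by split_ifs <;> simp) 1
  have h2 := prod_one_add_mul_le (W := W) (c := -1) fun i => by linarith [hW1 i]
  rw [one_mul] at h
  have hsub : {ω : Index d → Bool | ¬ 0 < patCard ω} ⊆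
      {ω | (1:ℝ) ≤ ∏ i, (fun b : Bool => if b then (0:ℝ) else 1) (ω i)} := by
    intro ω hω
    have h3 : ∀ i, ω i = false := by
      simpa [patCard, Finset.filter_eq_empty_iff] using hω
    simp [h3]
  refine (measureReal_mono hsub).trans (h.trans (le_trans (le_of_eq ?_) (h2.trans_eq ?_)))
  · refine Finset.prod_congr rfl fun i _ => ?_
    simp only [if_true, Bool.false_eq_true, if_false]
    ring
  · rw [neg_one_mul]

theorem le_log_five_quarters : (29 / 130 : ℝ) ≤ Real.log (5 / 4) := by
  rw [Real.le_log_iff_exp_le (by norm_num)]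
  refine (Real.exp_bound' (by norm_num) (by norm_num) (n := 6) (by norm_num)).trans ?_
  simp only [Finset.sum_range_succ, Finset.sum_range_zero, Nat.factorial]
  norm_num

theorem measureReal_patCard_gt_le (hW0 : ∀ i, 0 < W i) (hW1 : ∀ i, W i ≤ 1) :
    (sampleMeasure W).real {ω | ¬ (patCard ω : ℝ) ≤ 5 / 4 * ∑ i, W i} ≤
      Real.exp (-(3 / 104) * ∑ i, W i) := by
  have := isProbabilityMeasure_sampleMeasure hW0 hW1
  set S := ∑ i, W i
  have hS : 0 ≤ S := Finset.sum_nonneg fun i _ => (hW0 i).le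
  set s := Real.log (5 / 4)
  have h := mul_measureReal_le_prod hW0 hW1 (f := fun b => if b then 5 / 4 else 1)
    (fun b => by split_ifs <;> norm_num) (Real.exp (s * (5 / 4 * S)))
  have h2 := prod_one_add_mul_le (W := W) (c := 1 / 4) fun i => by linarith [hW0 i]
  have hsub : {ω : Index d → Bool | ¬ (patCard ω : ℝ) ≤ 5 / 4 * S} ⊆
      {ω | Real.exp (s * (5 / 4 * S)) ≤ ∏ i, (fun b : Bool => if b then (5 / 4 : ℝ) else 1) (ω i)} := by
    intro ω hω
    have h3 : ∏ i, (if ω i then (5 / 4 : ℝ) else 1) = Real.exp (s * patCard ω) := by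
      rw [Real.exp_mul, Real.exp_log (by norm_num), Finset.prod_ite, Finset.prod_const,
        Finset.prod_const_one, mul_one, patCard, Real.rpow_natCast]
    change Real.exp (s * (5 / 4 * S)) ≤ ∏ i, (if ω i then (5 / 4 : ℝ) else 1)
    rw [h3]
    have h4 := (not_le.1 hω).le
    have h5 : 0 ≤ s := Real.log_nonneg (by norm_num)
    gcongr
  refine (measureReal_mono hsub).trans ?_
  have h6 : ∏ i, (W i * (if true then (5 / 4 : ℝ) else 1) + (1 - W i) *
      (if false then (5 / 4 : ℝ) else 1)) = ∏ i, (1 + 1 / 4 * W i) := by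
    refine Finset.prod_congr rfl fun i _ => ?_
    simp only [if_true, Bool.false_eq_true, if_false]
    ring
  have h7 := h.trans (h6.trans_le h2)
  rw [mul_comm, ← le_div_iff₀ (Real.exp_pos _), ← Real.exp_sub] at h7
  refine h7.trans (Real.exp_le_exp.2 ?_)
  have h8 := le_log_five_quarters
  have h9 : 29 / 130 * S ≤ s * S := by gcongr
  linarith

theorem sqrt_prod_le_sum (hent : ∀ i, 1 / √(∏ j, (d j : ℝ)) ≤ W i) :
    √(∏ j, (d j : ℝ)) ≤ ∑ i, W i := by
  have hc : (Fintype.card (Index d) : ℝ) = ∏ j, (d j : ℝ) := by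
    rw [Fintype.card_pi, Nat.cast_prod]
    simp only [Fintype.card_fin]
  calc √(∏ j, (d j : ℝ)) = ∑ _i : Index d, 1 / √(∏ j, (d j : ℝ)) := by
        rw [Finset.sum_const, Finset.card_univ, nsmul_eq_mul, hc, mul_one_div, Real.div_sqrt]
    _ ≤ _ := Finset.sum_le_sum fun i _ => hent i

end Card

theorem twenty_four_le_of_exp_lt {x : ℝ} (h : 2 * Real.exp (-(3 / 104) * x) < 1) : 24 ≤ x := by
  by_contra! hx
  have h1 : Real.exp (-(3 / 104) * x) < 1 / 2 := by linarith
  rw [← Real.lt_log_iff_exp_lt (by norm_num), one_div, Real.log_inv] at h1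
  have := Real.log_two_gt_d9
  linarith

theorem abs_le_infNorm (X : Tensor d) (i : Index d) : |X i| ≤ infNorm X :=
  le_ciSup (f := fun i => |X i|) (Set.finite_range _).bddAbove i

theorem frobNorm_epow_half {W : Tensor d} (hW0 : ∀ i, 0 < W i) :
    frobNorm (epow W (1/2)) = √(∑ i, W i) := by
  rw [frobNorm]
  congr 1
  refine Finset.sum_congr rfl fun i _ => ?_
  rw [epow_half, Real.sq_sqrt (hW0 i).le]

theorem relative_error_le {r : Fin n → ℕ} {D l : Fin n → ℝ} {F S N β σ : ℝ} (hS : 0 < S) (hN : 0 < N)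
    (hNS : N ≤ 5 / 4 * S) (hβ : 0 ≤ β) (hσ : 0 ≤ σ) (hl : ∀ k, 0 ≤ l k)
    (hF : F ≤ 3 * ∑ k, √(r k) * (√(r k) * β * (2 * √(D k) * l k) + 4 * σ * √(D k) * l k)) :
    F / √S ≤ √5 * β / √N * (∑ k, 3 * (r k : ℝ) * √(D k) * l k) +
      √5 * σ / √N * (∑ k, 6 * √((r k : ℝ) * D k) * l k) := by
  have hS' := Real.sqrt_pos.2 hS
  have hN' := Real.sqrt_pos.2 hN
  have h1 : 1 / √S ≤ √5 / (2 * √N) := by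
    rw [div_le_div_iff₀ hS' (by positivity), one_mul, ← Real.sqrt_mul (by norm_num)]
    refine Real.le_sqrt_of_sq_le ?_
    rw [mul_pow, Real.sq_sqrt hN.le]
    linarith
  set Q := ∑ k, √(r k) * (√(r k) * β * (2 * √(D k) * l k) + 4 * σ * √(D k) * l k) with hQ
  have hQ0 : 0 ≤ Q := Finset.sum_nonneg fun k _ => by
    have := hl k
    positivity
  calc F / √S = F * (1 / √S) := by ring
    _ ≤ 3 * Q * (1 / √S) := by gcongr
    _ ≤ 3 * Q * (√5 / (2 * √N)) := by gcongr
    _ = _ := by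
        rw [hQ, Finset.mul_sum, Finset.sum_mul, Finset.mul_sum, Finset.mul_sum,
          ← Finset.sum_add_distrib]
        refine Finset.sum_congr rfl fun k _ => ?_
        rw [Real.sqrt_mul (Nat.cast_nonneg _)]
        have h2 : (r k : ℝ) = √(r k) * √(r k) := (Real.mul_self_sqrt (Nat.cast_nonneg _)).symm
        generalize √(r k : ℝ) = q at h2
        rw [h2]
        field_simp
        ring

theorem weighted_hosvd_bound_random_pattern
    {n : ℕ} {d : Fin n → ℕ} (w : ∀ j, Fin (d j) → ℝ) (W : Tensor d)
    (hW : W = outer w)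
    (hent : ∀ i, 1 / Real.sqrt (∏ j, (d j : ℝ)) ≤ W i ∧ W i ≤ 1)
    (r : Fin n → ℕ) :
    ENNReal.ofReal (1 - 2 * Real.exp (-(3/104) * Real.sqrt (∏ j, (d j : ℝ)))
        - ∑ k, 2 / Dk d k) ≤
      sampleMeasure W {ω : Index d → Bool |
        ∀ σ : ℝ, 0 < σ → ∀ β : ℝ, 0 < β →
        ∀ T : Tensor d, TuckerRankEq T r → infNorm T ≤ β →
        ∀ That : Tensor d → Tensor d,
          (∀ z : Tensor d,
            IsHOSVDEstimate W r (fun i => bindic ω i * (T i + z i)) (That z)) →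
          ENNReal.ofReal (1 - ∑ k, 1 / Dk d k) ≤
            gaussianTensor d σ {z : Tensor d |
              frobNorm (hadamard (epow W (1/2)) (fun i => T i - That z i))
                  / frobNorm (epow W (1/2)) ≤
                Real.sqrt 5 * β / Real.sqrt (patCard ω : ℝ) *
                    (∑ k, 3 * (r k : ℝ) * Real.sqrt (Dk d k) * Real.log (Dk d k))
                  + Real.sqrt 5 * σ / Real.sqrt (patCard ω : ℝ) *
                    (∑ k, 6 * Real.sqrt ((r k : ℝ) * Dk d k) * Real.log (Dk d k))}} := by
  set P : ℝ := ∏ j, (d j : ℝ) with hP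
  have hsum : 0 ≤ ∑ k, 2 / Dk d k :=
    Finset.sum_nonneg fun k _ => div_nonneg zero_le_two (Dk_nonneg k)
  by_cases hvac : 1 - 2 * Real.exp (-(3/104) * √P) - ∑ k, 2 / Dk d k ≤ 0
  · rw [ENNReal.ofReal_of_nonpos hvac]
    exact zero_le
  have hP24 : 24 ≤ √P := twenty_four_le_of_exp_lt (by linarith)
  have hn : n ≠ 0 := by
    rintro rfl
    norm_num [hP] at hP24
  have hsP : 0 < √P := by linarith
  have hW0 : ∀ i, 0 < W i := fun i => lt_of_lt_of_le (by positivity) (hent i).1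
  have hW1 : ∀ i, W i ≤ 1 := fun i => (hent i).2
  have hDP : ∀ k, 2 * √P ≤ Dk d k := two_mul_sqrt_prod_le_Dk
  have hD : ∀ k, 48 ≤ Dk d k := fun k => by linarith [hDP k]
  have hWD : ∀ k i, 1 / W i ≤ Dk d k / 2 := fun k i => by
    have h1 : 1 / W i ≤ √P := by
      rw [one_div, inv_le_comm₀ (hW0 i) hsP, ← one_div]
      exact (hent i).1
    linarith [hDP k]
  have hSP : √P ≤ ∑ i, W i := sqrt_prod_le_sum fun i => (hent i).1
  have := isProbabilityMeasure_sampleMeasure hW0 hW1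
  set A : Fin n → Set (Index d → Bool) := fun k => {ω | ¬ specNorm (matricize k
    fun i => (bindic ω i - W i) / √(W i)) ≤ 2 * √(Dk d k) * Real.log (Dk d k)} with hA
  set B : Fin n → Set (Index d → Bool) := fun k =>
    {ω | ¬ Real.exp (1 / (4 * Real.log (Dk d k)) - 4 * Real.log (Dk d k)) *
        lineSum k (fun i => noiseWeight k W i (ω i)) ≤ 1 / Dk d k} with hB
  rw [sub_sub]
  refine ofReal_one_sub_le_measure (s := ({ω | ¬ 0 < patCard ω} ∪
    {ω | ¬ (patCard ω : ℝ) ≤ 5 / 4 * ∑ i, W i}) ∪ ⋃ k, (A k ∪ B k)) ?_ ?_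
  · intro ω hω
    by_contra hbad
    refine hω ?_
    simp only [Set.mem_union, Set.mem_iUnion, not_or, not_exists, hA, hB, Set.mem_ofPred_eq,
      not_not] at hbad
    obtain ⟨⟨hN0, hN⟩, hAB⟩ := hbad
    intro σ hσ β hβ T hT hTβ That hest
    have : IsProbabilityMeasure (gaussianTensor d σ) := by
      unfold gaussianTensor
      infer_instance
    refine ofReal_one_sub_le_measure (s := ⋃ k, {z | ¬ specNorm (matricize k
        fun i => bindic ω i / √(W i) * z i) ≤ 4 * σ * √(Dk d k) * Real.log (Dk d k)}) ?_ ?_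
    · intro z hz
      by_contra hzbad
      refine hz ?_
      simp only [Set.mem_iUnion, not_exists, Set.mem_ofPred_eq, not_not] at hzbad
      have hF := frobNorm_weighted_error_le w hW hW0 hn ω hβ.le
        (fun i => (abs_le_infNorm T i).trans hTβ) hT (hest z) (fun k => (hAB k).1) hzbad
      rw [Set.mem_ofPred_eq, frobNorm_epow_half hW0]
      exact relative_error_le (by linarith) (by exact_mod_cast hN0) hN hβ.le hσ.le
        (fun k => by linarith [le_log_of_le (hD k)]) hF
    · refine (measureReal_iUnion_fintype_le _).trans (Finset.sum_le_sum fun k _ => ?_)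
      exact (measureReal_noise_le hW0 k (hD k) (hWD k) hσ ω).trans (hAB k).2
  · refine (measureReal_union_le _ _).trans (add_le_add ?_ ?_)
    · have h1 := measureReal_patCard_eq_zero_le hW0 hW1
      have h2 := measureReal_patCard_gt_le hW0 hW1
      have h3 : Real.exp (-∑ i, W i) ≤ Real.exp (-(3/104) * √P) :=
        Real.exp_le_exp.2 (by linarith)
      have h4 : Real.exp (-(3/104) * ∑ i, W i) ≤ Real.exp (-(3/104) * √P) :=
        Real.exp_le_exp.2 (by linarith)
      refine (measureReal_union_le _ _).trans ?_
      linarith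
    · refine (measureReal_iUnion_fintype_le _).trans (Finset.sum_le_sum fun k _ => ?_)
      refine (measureReal_union_le _ _).trans ?_
      have h1 := measureReal_sampling_deviation_le hW0 hW1 k (hD k) (hWD k)
      have h2 := measureReal_lineSum_noiseWeight_le hW0 hW1 k (hD k)
      have h3 : 13 / 10 / Dk d k + 7 / 10 / Dk d k = 2 / Dk d k := by ring
      linarith

end WTC
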